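/- arXiv:2312.03688 — 2 statements merged into one kernel-verified Lean document; each statement's English description precedes it below -/
import Mathlib

section
/- For every n-vertex d-regular graph G with d > 2, tww(G) ≤ n^{(d−2)/(2d−2)} · exp(O(d^{−1}·√(log n)·log log n + log d)), where the implied constant is absolute. -/
noncomputable section

namespace TwwPaper

open Finset

variable {V : Type*}

/-- The number of edges of `G` with both endpoints in `X`. -/
def edgesIn (G : SimpleGraph V) (X : Finset V) : ℕ :=
  Nat.card {e : Sym2 V // e ∈ G.edgeSet ∧ ∀ v ∈ e, v ∈ X}

/-- The number of edges of `G`. -/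
def edgeCount (G : SimpleGraph V) : ℕ := Nat.card G.edgeSet

/-- The maximum average degree of `G`: the maximum over nonempty vertex subsets `X`
of `2 e(G[X]) / |X|`. -/
def mad [Fintype V] (G : SimpleGraph V) : ℝ :=
  ⨆ X : {X : Finset V // X.Nonempty}, (2 * edgesIn G X.1 : ℝ) / X.1.card

/-- The degree of a vertex. -/
def deg (G : SimpleGraph V) (v : V) : ℕ := Nat.card (G.neighborSet v)

/-- The maximum degree `Δ(G)`. -/
def maxDeg [Fintype V] (G : SimpleGraph V) : ℕ := univ.sup (deg G)

/-- `G` is `d`-regular. -/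
def IsReg (G : SimpleGraph V) (d : ℕ) : Prop := ∀ v, deg G v = d

/-- `G` admits an orientation with maximum outdegree at most one:
an assignment of a tail (source) vertex to each edge, no vertex being
the tail of two distinct edges. -/
def HasOrientationOutdegLEOne (G : SimpleGraph V) : Prop :=
  ∃ f : G.edgeSet → V, (∀ e : G.edgeSet, f e ∈ (e : Sym2 V)) ∧ Function.Injective f

/-- Two lists (sequences) of the same length `r` are close if they contain a common
subsequence of length `r - 1`, obtained by deleting one entry from each. -/
def Close {S : Type*} (L M : List S) : Prop :=
  ∃ i < L.length, ∃ j < M.length, L.eraseIdx i = M.eraseIdx j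

section Partitions

variable [Fintype V] [DecidableEq V]

/-- `Q` is obtained from `P` by merging the two distinct parts `A` and `B`. -/
def IsMergeStep (P Q : Finpartition (univ : Finset V)) : Prop :=
  ∃ A ∈ P.parts, ∃ B ∈ P.parts, A ≠ B ∧
    Q.parts = insert (A ∪ B) ((P.parts.erase A).erase B)

/-- Degree of the part `A` in the quotient graph `G / P`. -/
def quotDeg (G : SimpleGraph V) (P : Finpartition (univ : Finset V)) (A : Finset V) : ℕ :=
  Nat.card {B : Finset V // B ∈ P.parts ∧ B ≠ A ∧ ∃ u ∈ A, ∃ v ∈ B, G.Adj u v}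

/-- Red degree of the part `A` with respect to the partition `P`: the number of other
parts `B` which are neither fully adjacent nor fully non-adjacent to `A`. -/
def redDeg (G : SimpleGraph V) (P : Finpartition (univ : Finset V)) (A : Finset V) : ℕ :=
  Nat.card {B : Finset V // B ∈ P.parts ∧ B ≠ A ∧ (∃ u ∈ A, ∃ v ∈ B, G.Adj u v) ∧
    ¬ (∀ u ∈ A, ∀ v ∈ B, G.Adj u v)}

/-- There is a sequence of partitions of `V(G)`, starting at the discrete partition,
ending with at most one part, each obtained from the previous one by merging two parts,
such that every part of every intermediate partition has `degFn`-degree at most `w`. -/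
def SeqOK (G : SimpleGraph V)
    (degFn : SimpleGraph V → Finpartition (univ : Finset V) → Finset V → ℕ) (w : ℕ) : Prop :=
  ∃ n : ℕ, ∃ P : Fin (n + 1) → Finpartition (univ : Finset V),
    (∀ A ∈ (P 0).parts, A.card = 1) ∧
    (P (Fin.last n)).parts.card ≤ 1 ∧
    (∀ i : Fin n, IsMergeStep (P i.castSucc) (P i.succ)) ∧
    (∀ i, ∀ A ∈ (P i).parts, degFn G (P i) A ≤ w)

/-- The sparse twin-width of `G`: the least `w` such that `G` can be contracted to a
single vertex by iterated pairwise identifications with all intermediate (quotient)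
graphs of maximum degree at most `w`. -/
def stww (G : SimpleGraph V) : ℕ := sInf {w | SeqOK G quotDeg w}

/-- The twin-width of `G`, via contraction sequences minimizing the maximum red degree. -/
def tww (G : SimpleGraph V) : ℕ := sInf {w | SeqOK G redDeg w}

/-- The quotient graph `G / P`: parts of `P` are adjacent iff some edge of `G` joins them. -/
def quotGraph (G : SimpleGraph V) (P : Finpartition (univ : Finset V)) :
    SimpleGraph {A : Finset V // A ∈ P.parts} :=
  SimpleGraph.fromRel (fun A B => ∃ u ∈ A.1, ∃ v ∈ B.1, G.Adj u v)

end Partitions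

/-- A graph is `w`-degenerate if every nonempty (induced) subgraph has a vertex of
degree at most `w` in it. -/
def Degenerate {W : Type*} (w : ℕ) (H : SimpleGraph W) : Prop :=
  ∀ s : Finset W, s.Nonempty → ∃ a ∈ s, Nat.card {b : W // b ∈ s ∧ H.Adj a b} ≤ w

/-- The graph `Π(r₁,…,r_a; b, q)`: vertices are tuples `(v₁,…,v_a)` with `vᵢ ∈ [q]^{rᵢ}`,
two tuples being adjacent iff (they are distinct and) at least `b` coordinates are
pairwise equal or close. -/
def PiGraph (a b q : ℕ) (rfn : Fin a → ℕ) : SimpleGraph (∀ i : Fin a, Fin (rfn i) → Fin q) :=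
  SimpleGraph.fromRel (fun u v => ∃ I : Finset (Fin a), I.card = b ∧
    ∀ i ∈ I, u i = v i ∨ Close (List.ofFn (u i)) (List.ofFn (v i)))

open scoped Classical in
theorem exists_injective_of_weights {ι α : Type*} [Fintype ι] [Fintype α] (w : ι → α → ℝ)
    (h0 : ∀ i a, 0 ≤ w i a) (h1 : ∀ i, 1 ≤ ∑ a, w i a) (h2 : ∀ a, ∑ i, w i a ≤ 1) :
    ∃ f : ι → α, Function.Injective f ∧ ∀ i, w i (f i) ≠ 0 := by
  have key := (Finset.all_card_le_biUnion_card_iff_exists_injective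
    (fun i => univ.filter (fun a => w i a ≠ 0))).1 ?_
  · obtain ⟨f, hf, hm⟩ := key
    exact ⟨f, hf, fun i => by simpa using hm i⟩
  · intro s
    set N := s.biUnion (fun i => univ.filter (fun a => w i a ≠ 0)) with hN
    have : (s.card : ℝ) ≤ N.card := calc
      (s.card : ℝ) = ∑ i ∈ s, (1 : ℝ) := by simp
      _ ≤ ∑ i ∈ s, ∑ a, w i a := sum_le_sum fun i _ => h1 i
      _ = ∑ i ∈ s, ∑ a ∈ N, w i a := by
        refine sum_congr rfl fun i hi => (sum_subset (subset_univ N) fun a _ ha => ?_).symm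
        by_contra hne
        exact ha (mem_biUnion.2 ⟨i, hi, by simpa using hne⟩)
      _ = ∑ a ∈ N, ∑ i ∈ s, w i a := sum_comm
      _ ≤ ∑ a ∈ N, ∑ i, w i a := sum_le_sum fun a _ =>
        sum_le_sum_of_subset_of_nonneg (subset_univ s) fun i _ _ => h0 i a
      _ ≤ ∑ a ∈ N, (1 : ℝ) := sum_le_sum fun a _ => h2 a
      _ = N.card := by simp
    exact_mod_cast this

/-- Half of the label set `Fin d`, with the middle label (for odd `d`) counted by one half. -/
noncomputable def halfWeight (d : ℕ) (b : Bool) (i : Fin d) : ℝ :=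
  if 2 * i.val + 1 = d then 1 / (2 * d) else
    if (decide (d < 2 * i.val + 1)) = b then 1 / d else 0

theorem halfWeight_nonneg (d : ℕ) (b : Bool) (i : Fin d) : 0 ≤ halfWeight d b i := by
  unfold halfWeight; split_ifs <;> positivity

theorem halfWeight_add (d : ℕ) (i : Fin d) :
    halfWeight d false i + halfWeight d true i = 1 / d := by
  unfold halfWeight
  by_cases h : 2 * i.val + 1 = d
  · simp only [h, if_true]
    have : (0 : ℝ) < d := by exact_mod_cast i.pos
    field_simp; norm_num
  · by_cases h' : d < 2 * i.val + 1 <;> simp [h, h']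

theorem halfWeight_rev (d : ℕ) (b : Bool) (i : Fin d) :
    halfWeight d b i.rev = halfWeight d (!b) i := by
  have hi := i.isLt
  unfold halfWeight
  rw [Fin.val_rev]
  by_cases h : 2 * i.val + 1 = d
  · rw [if_pos h, if_pos (by omega)]
  · rw [if_neg h, if_neg (by omega)]
    by_cases h' : d < 2 * i.val + 1
    · have : ¬ d < 2 * (d - (i.val + 1)) + 1 := by omega
      cases b <;> simp [h', this]
    · have : d < 2 * (d - (i.val + 1)) + 1 := by omega
      cases b <;> simp [h', this]

theorem sum_halfWeight {d : ℕ} (hd : 0 < d) (b : Bool) : ∑ i, halfWeight d b i = 1 / 2 := by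
  have hsym : ∑ i, halfWeight d false i = ∑ i, halfWeight d true i := by
    rw [← Equiv.sum_comp Fin.revPerm]
    exact sum_congr rfl fun i _ => halfWeight_rev d false i
  have hadd : ∑ i, halfWeight d false i + ∑ i, halfWeight d true i = 1 := by
    rw [← sum_add_distrib, sum_congr rfl fun i _ => halfWeight_add d i]
    have : (d : ℝ) ≠ 0 := by positivity
    simp [this]
  cases b <;> linarith

theorem le_of_halfWeight_ne_zero {d : ℕ} {i : Fin d} (h : halfWeight d false i ≠ 0) :
    2 * i.val + 1 ≤ d := by
  by_contra hlt
  exact h (by simp [halfWeight, show 2 * i.val + 1 ≠ d by omega, show d < 2 * i.val + 1 by omega])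

theorem ge_of_halfWeight_ne_zero {d : ℕ} {i : Fin d} (h : halfWeight d true i ≠ 0) :
    d ≤ 2 * i.val + 1 := by
  by_contra hlt
  exact h (by simp [halfWeight, show 2 * i.val + 1 ≠ d by omega,
    show ¬ d < 2 * i.val + 1 by omega])

open scoped Classical in
theorem exists_weighted_labelling {V E : Type*} [Fintype V] [Fintype E] (inc : V → E → Prop)
    {d : ℕ} (hd : 0 < d) (hV : ∀ v, #{e | inc v e} = d) (hE : ∀ e, #{v | inc v e} = 2) :
    ∃ φ : E × Bool → V × Fin d, Function.Injective φ ∧ (∀ x, inc (φ x).1 x.1) ∧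
      ∀ x, halfWeight d x.2 (φ x).2 ≠ 0 := by
  obtain ⟨φ, hφ, hw⟩ := exists_injective_of_weights
    (fun (x : E × Bool) (y : V × Fin d) => if inc y.1 x.1 then halfWeight d x.2 y.2 else 0)
    (fun x y => by split_ifs; exacts [halfWeight_nonneg _ _ _, le_rfl])
    (fun x => by
      rw [Fintype.sum_prod_type]
      have : ∀ v, ∑ i, (if inc v x.1 then halfWeight d x.2 i else 0) =
          if inc v x.1 then 1 / 2 else 0 := fun v => by
        split_ifs <;> simp [sum_halfWeight hd]
      simp only [this]
      rw [← sum_filter, sum_const, hE]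
      norm_num)
    (fun y => by
      rw [Fintype.sum_prod_type]
      have : ∀ e, ∑ b, (if inc y.1 e then halfWeight d b y.2 else 0) =
          if inc y.1 e then 1 / (d : ℝ) else 0 := fun e => by
        split_ifs
        · rw [Fintype.sum_bool, add_comm, halfWeight_add]
        · simp
      simp only [this]
      rw [← sum_filter, sum_const, hV, nsmul_eq_mul, mul_one_div_cancel (by positivity)])
  refine ⟨φ, hφ, fun x => ?_, fun x => ?_⟩ <;>
  · have := hw x
    simp only [ne_eq, ite_eq_right_iff, Classical.not_imp] at this
    tauto

open scoped Classical in
theorem bijective_of_incidence {V E : Type*} [Fintype V] [Fintype E] (inc : V → E → Prop)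
    {d : ℕ} (hV : ∀ v, #{e | inc v e} = d) (hE : ∀ e, #{v | inc v e} = 2)
    {φ : E × Bool → V × Fin d} (hφ : Function.Injective φ) : Function.Bijective φ := by
  rw [Fintype.bijective_iff_injective_and_card]
  refine ⟨hφ, ?_⟩
  have := sum_card_bipartiteAbove_eq_sum_card_bipartiteBelow (s := univ) (t := univ) inc
  simp only [bipartiteAbove, bipartiteBelow, hV, hE, sum_const, card_univ, smul_eq_mul] at this
  simp [this]

open scoped Classical in
/-- If every `v` is incident with `d ≥ 3` edges and every edge with two vertices, one can give
each edge two distinct labels in `Fin d`, each held by an end of that edge, so that no vertex holds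
the same label twice. -/
theorem exists_labelling {V E : Type*} [Fintype V] [Fintype E] (inc : V → E → Prop)
    {d : ℕ} (hd : 2 < d) (hV : ∀ v, #{e | inc v e} = d) (hE : ∀ e, #{v | inc v e} = 2) :
    ∃ φ : E × Bool → V × Fin d, Function.Injective φ ∧ (∀ x, inc (φ x).1 x.1) ∧
      ∀ e, (φ (e, false)).2 ≠ (φ (e, true)).2 := by
  obtain ⟨φ, hφ, hinc, hw⟩ := exists_weighted_labelling inc (by omega) hV hE
  have hle : ∀ e, 2 * (φ (e, false)).2.val + 1 ≤ d := fun e =>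
    le_of_halfWeight_ne_zero (hw (e, false))
  have hge : ∀ e, d ≤ 2 * (φ (e, true)).2.val + 1 := fun e => ge_of_halfWeight_ne_zero (hw (e, true))
  rcases Nat.even_or_odd' d with ⟨s, rfl | rfl⟩
  · refine ⟨φ, hφ, hinc, fun e he => ?_⟩
    have h1 := hle e
    have h2 := hge e
    rw [he] at h1
    omega
  have hsurj := (bijective_of_incidence inc hV hE hφ).2
  let mid : Fin (2 * s + 1) := ⟨s, by omega⟩
  choose x hx using fun v => hsurj (v, mid)
  -- a second edge held at `v` by a copy of the same kind as the one carrying the middle label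
  have hy : ∀ v, ∃ e, e ≠ (x v).1 ∧ (φ (e, (x v).2)).1 = v := by
    intro v
    rcases hb : (x v).2 with _ | _
    · obtain ⟨⟨e, b⟩, he⟩ := hsurj (v, ⟨0, by omega⟩)
      rcases b with _ | _
      · refine ⟨e, fun h => ?_, by rw [he]⟩
        have : x v = (e, false) := by rw [h, ← hb]
        have h1 := hx v
        rw [this, he] at h1
        simp only [mid, Prod.mk.injEq, Fin.mk.injEq, true_and] at h1
        omega
      · have := hge e
        rw [he] at this
        simp at this
        omega
    · obtain ⟨⟨e, b⟩, he⟩ := hsurj (v, ⟨2 * s, by omega⟩)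
      rcases b with _ | _
      · have := hle e
        rw [he] at this
        simp at this
        omega
      · refine ⟨e, fun h => ?_, by rw [he]⟩
        have : x v = (e, true) := by rw [h, ← hb]
        have h1 := hx v
        rw [this, he] at h1
        simp only [mid, Prod.mk.injEq, Fin.mk.injEq, true_and] at h1
        omega
  obtain ⟨m, hm, hmw⟩ := exists_injective_of_weights
    (fun (v : V) (e : E) => if (φ (e, (x v).2)).1 = v then (1 / 2 : ℝ) else 0)
    (fun v e => by split_ifs <;> norm_num)
    (fun v => by
      obtain ⟨e, hne, he⟩ := hy v
      rw [← sum_filter, sum_const, nsmul_eq_mul]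
      have : 2 ≤ #{e | (φ (e, (x v).2)).1 = v} := by
        refine (card_pair hne).ge.trans (card_le_card fun a ha => ?_)
        rcases mem_insert.1 ha with rfl | ha
        · simpa using he
        · rw [mem_singleton] at ha
          subst ha
          simp [hx]
      have : (2 : ℝ) ≤ #{e | (φ (e, (x v).2)).1 = v} := by exact_mod_cast this
      linarith)
    (fun e => by
      rw [← sum_filter, sum_const, nsmul_eq_mul]
      have : #{v | (φ (e, (x v).2)).1 = v} ≤ 2 := by
        refine (card_le_card (t := {(φ (e, false)).1, (φ (e, true)).1}) fun v hv => ?_).trans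
          card_le_two
        have hv : (φ (e, (x v).2)).1 = v := by simpa using hv
        rcases hb : (x v).2 with _ | _ <;> rw [hb] at hv <;> simp [hv]
      have : (#{v | (φ (e, (x v).2)).1 = v} : ℝ) ≤ 2 := by exact_mod_cast this
      linarith)
  have hmv : ∀ v, (φ (m v, (x v).2)).1 = v := fun v => by simpa using hmw v
  let j : V → Fin (2 * s + 1) := fun v => (φ (m v, (x v).2)).2
  have hj : ∀ v, φ (m v, (x v).2) = (v, j v) := fun v => Prod.ext (hmv v) rfl
  have hfalse : ∀ e, (Equiv.swap mid (j (φ (e, false)).1) (φ (e, false)).2).val ≤ s ∧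
      ((Equiv.swap mid (j (φ (e, false)).1) (φ (e, false)).2).val = s →
        (x (φ (e, false)).1).2 = false ∧ m (φ (e, false)).1 = e) := by
    intro e
    obtain ⟨v, i, hvi⟩ : ∃ v i, φ (e, false) = (v, i) := ⟨_, _, rfl⟩
    have h1 := hle e
    rw [hvi] at h1 ⊢
    simp only at h1 ⊢
    rcases hb : (x v).2 with _ | _
    · have h2 := hle (m v)
      have h3 := hj v
      rw [hb] at h3
      rw [h3] at h2
      simp only at h2
      have hE : i = j v → m v = e := fun h => by
        have := hφ (hvi.trans ((by rw [h] : (v, i) = (v, j v)).trans h3.symm))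
        exact (congrArg Prod.fst this).symm
      rw [Equiv.swap_apply_def]
      split_ifs with h4 h5
      · refine ⟨by omega, fun h => ⟨rfl, hE ?_⟩⟩
        rw [h4]; exact Fin.ext (by simp [mid, h])
      · exact ⟨le_rfl, fun _ => ⟨rfl, hE h5⟩⟩
      · exact ⟨by omega, fun h => absurd (Fin.ext h : i = mid) h4⟩
    · have h2 := hge (m v)
      have h3 := hj v
      rw [hb] at h3
      rw [h3] at h2
      simp only at h2
      have h4 : i ≠ mid := fun h => by
        have := hφ (hvi.trans ((by rw [h] : (v, i) = (v, mid)).trans (hx v).symm))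
        rw [← this] at hb
        simp at hb
      have h4' : i.val ≠ s := fun h => h4 (Fin.ext h)
      rw [Equiv.swap_apply_of_ne_of_ne h4 (fun h => by rw [h] at h1 h4'; omega)]
      exact ⟨by omega, fun h => absurd h h4'⟩
  have htrue : ∀ e, s ≤ (Equiv.swap mid (j (φ (e, true)).1) (φ (e, true)).2).val ∧
      ((Equiv.swap mid (j (φ (e, true)).1) (φ (e, true)).2).val = s →
        (x (φ (e, true)).1).2 = true ∧ m (φ (e, true)).1 = e) := by
    intro e
    obtain ⟨v, i, hvi⟩ : ∃ v i, φ (e, true) = (v, i) := ⟨_, _, rfl⟩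
    have h1 := hge e
    rw [hvi] at h1 ⊢
    simp only at h1 ⊢
    rcases hb : (x v).2 with _ | _
    · have h2 := hle (m v)
      have h3 := hj v
      rw [hb] at h3
      rw [h3] at h2
      simp only at h2
      have h4 : i ≠ mid := fun h => by
        have := hφ (hvi.trans ((by rw [h] : (v, i) = (v, mid)).trans (hx v).symm))
        rw [← this] at hb
        simp at hb
      have h4' : i.val ≠ s := fun h => h4 (Fin.ext h)
      rw [Equiv.swap_apply_of_ne_of_ne h4 (fun h => by rw [h] at h1 h4'; omega)]
      exact ⟨by omega, fun h => absurd h h4'⟩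
    · have h2 := hge (m v)
      have h3 := hj v
      rw [hb] at h3
      rw [h3] at h2
      simp only at h2
      have hE : i = j v → m v = e := fun h => by
        have := hφ (hvi.trans ((by rw [h] : (v, i) = (v, j v)).trans h3.symm))
        exact (congrArg Prod.fst this).symm
      rw [Equiv.swap_apply_def]
      split_ifs with h4 h5
      · refine ⟨by omega, fun h => ⟨rfl, hE ?_⟩⟩
        rw [h4]; exact Fin.ext (by simp [mid, h])
      · exact ⟨le_rfl, fun _ => ⟨rfl, hE h5⟩⟩
      · exact ⟨by omega, fun h => absurd (Fin.ext h : i = mid) h4⟩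
  refine ⟨fun y => ((φ y).1, Equiv.swap mid (j (φ y).1) (φ y).2), fun y z hyz => hφ ?_, hinc,
    fun e he => ?_⟩
  · obtain ⟨h1, h2⟩ := Prod.mk.inj hyz
    rw [h1] at h2
    exact Prod.ext h1 ((Equiv.injective _) h2)
  · simp only at he
    have h1 := hfalse e
    have h2 := htrue e
    rw [← he] at h2
    have h3 := le_antisymm h1.1 h2.1
    obtain ⟨h4, h5⟩ := h1.2 h3
    obtain ⟨h6, h7⟩ := h2.2 h3
    have := hm (h5.trans h7.symm)
    rw [this, h6] at h4
    simp at h4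

theorem card_incident_edges [Fintype V] {G : SimpleGraph V} {d : ℕ} (hG : IsReg G d) (v : V) :
    Nat.card {e : G.edgeSet // v ∈ (e : Sym2 V)} = d := by
  classical
  rw [← hG v, deg, ← Nat.card_congr (G.incidenceSetEquivNeighborSet v)]
  exact Nat.card_congr ⟨fun e => ⟨e.1.1, e.1.2, e.2⟩, fun e => ⟨⟨e.1, e.2.1⟩, e.2.2⟩,
    fun _ => rfl, fun _ => rfl⟩

/-- A `d`-regular graph, `d ≥ 3`, carries `d` functions `p i`, each moving every vertex to a
neighbour or fixing it, such that every edge is an arc of at least two of them. -/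
theorem exists_neighborMaps [Fintype V] {G : SimpleGraph V} {d : ℕ} (hd : 2 < d)
    (hG : IsReg G d) :
    ∃ p : Fin d → V → V, (∀ i v, p i v = v ∨ G.Adj v (p i v)) ∧
      ∀ u v, G.Adj u v → ∃ i j, i ≠ j ∧ (p i u = v ∨ p i v = u) ∧ (p j u = v ∨ p j v = u) := by
  classical
  obtain ⟨φ, hφ, hinc, hne⟩ := exists_labelling (fun (v : V) (e : G.edgeSet) => v ∈ (e : Sym2 V))
    hd (fun v => by
      rw [← card_incident_edges hG v, Nat.card_eq_fintype_card, Fintype.card_subtype]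
      congr)
    (fun e => by
      rw [← Sym2.card_toFinset_of_not_isDiag e.1 (G.not_isDiag_of_mem_edgeSet e.2)]
      congr 1; ext; simp)
  have hex : ∀ i v, ∃ w, (w = v ∨ G.Adj v w) ∧
      ∀ x, φ x = (v, i) → (x.1 : Sym2 V) = s(v, w) := by
    intro i v
    by_cases h : ∃ x, φ x = (v, i)
    · obtain ⟨x, hx⟩ := h
      have hv := hinc x
      rw [hx] at hv
      obtain ⟨w, hw⟩ := hv
      refine ⟨w, Or.inr ?_, fun y hy => ?_⟩
      · rw [← SimpleGraph.mem_edgeSet, ← hw]; exact x.1.2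
      · rw [hφ (hy.trans hx.symm), hw]
    · exact ⟨v, Or.inl rfl, fun x hx => absurd ⟨x, hx⟩ h⟩
  choose p hp1 hp2 using hex
  refine ⟨p, hp1, fun u v huv => ?_⟩
  let e : G.edgeSet := ⟨s(u, v), huv⟩
  have key : ∀ b, p (φ (e, b)).2 u = v ∨ p (φ (e, b)).2 v = u := fun b => by
    have h := hp2 (φ (e, b)).2 (φ (e, b)).1 (e, b) rfl
    rcases Sym2.mem_iff.1 (hinc (e, b)) with h' | h'
    · left
      rw [h'] at h
      exact (Sym2.congr_right.1 h).symm
    · right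
      rw [h'] at h
      exact (Sym2.congr_right.1 (Sym2.eq_swap.trans h)).symm
  exact ⟨_, _, hne e, key false, key true⟩

theorem card_preimage_neighborMap_le [Fintype V] [DecidableEq V] {G : SimpleGraph V} {d : ℕ}
    (hG : IsReg G d) {p : V → V} (hp : ∀ v, p v = v ∨ G.Adj v (p v)) (x : V) :
    #{u | p u = x} ≤ d + 1 := by
  classical
  have h : #(G.neighborFinset x) = d := by
    rw [← hG x, deg, Nat.card_eq_fintype_card]
    exact Set.toFinset_card _
  rw [← h]
  refine (card_le_card fun u hu => ?_).trans (card_insert_le x _)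
  obtain rfl : p u = x := by simpa using hu
  rcases hp u with h | h
  · rw [h]; exact mem_insert_self _ _
  · exact mem_insert_of_mem (by simpa using h.symm)

section Words

variable {X : Type*} (p : X → X) (r : ℕ)

/-- `x` lies on a cycle of `p` of length less than `r`. -/
def ShortCyclic (x : X) : Prop := ∃ m, 0 < m ∧ m < r ∧ p^[m] x = x

/-- The first `r` points of the orbit of `x`. -/
def shortOrbit (x : X) : Set X := {y | ∃ k < r, p^[k] x = y}

open scoped Classical in
/-- First letter of the word of `x`: the point `x`, or the cycle of `x` if that is short. -/
def firstLetter (x : X) : X ⊕ (Set X × ZMod (r + 1)) :=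
  if ShortCyclic p r x then Sum.inr (shortOrbit p r x, 0) else Sum.inl x

/-- The letter following a given letter in a word: words follow the map `p` until they reach a short
cycle, which emits letters of its own. -/
def nextLetter : X ⊕ (Set X × ZMod (r + 1)) → X ⊕ (Set X × ZMod (r + 1))
  | Sum.inl x => firstLetter p r (p x)
  | Sum.inr y => Sum.inr (y.1, y.2 + 1)

/-- The `k`-th letter of the word of `x`. -/
def letter (x : X) (k : ℕ) : X ⊕ (Set X × ZMod (r + 1)) := (nextLetter p r)^[k] (firstLetter p r x)

variable {p r}

theorem shortOrbit_map {x : X} (hx : ShortCyclic p r x) :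
    shortOrbit p r (p x) = shortOrbit p r x := by
  obtain ⟨m, hm0, hmr, hm⟩ := hx
  ext y
  constructor
  · rintro ⟨k, hk, rfl⟩
    rw [← Function.iterate_succ_apply]
    rcases Nat.lt_or_ge (k + 1) r with h | h
    · exact ⟨k + 1, h, rfl⟩
    · refine ⟨k + 1 - m, by omega, ?_⟩
      conv_lhs => rw [← hm]
      rw [← Function.iterate_add_apply]
      congr 2
      omega
  · rintro ⟨k, hk, rfl⟩
    rcases k with _ | k
    · refine ⟨m - 1, by omega, ?_⟩
      rw [← Function.iterate_succ_apply, Nat.succ_eq_add_one, Nat.sub_add_cancel hm0, hm]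
      rfl
    · exact ⟨k, by omega, rfl⟩

theorem shortCyclic_map {x : X} (hx : ShortCyclic p r x) : ShortCyclic p r (p x) := by
  obtain ⟨m, hm0, hmr, hm⟩ := hx
  exact ⟨m, hm0, hmr, by rw [← Function.iterate_succ_apply, Function.iterate_succ_apply', hm]⟩

theorem letter_map (x : X) :
    (∀ k, letter p r (p x) k = letter p r x k) ∨
      ∀ k, letter p r (p x) k = letter p r x (k + 1) := by
  by_cases hx : ShortCyclic p r x
  · left
    intro k
    have : firstLetter p r (p x) = firstLetter p r x := by
      simp [firstLetter, hx, shortCyclic_map hx, shortOrbit_map hx]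
    rw [letter, letter, this]
  · right
    intro k
    rw [letter, letter, Function.iterate_succ_apply]
    congr 1
    simp [firstLetter, hx, nextLetter]

theorem letter_succ (x : X) (k : ℕ) : letter p r x (k + 1) = nextLetter p r (letter p r x k) :=
  Function.iterate_succ_apply' _ _ _

theorem letter_add_of_inr {x : X} {k : ℕ} {O : Set X} {t : ZMod (r + 1)}
    (h : letter p r x k = Sum.inr (O, t)) (j : ℕ) :
    letter p r x (k + j) = Sum.inr (O, t + j) := by
  induction j with
  | zero => simpa using h
  | succ j ih => rw [← add_assoc, letter_succ, ih]; simp [nextLetter, add_assoc]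

theorem letter_spec (x : X) (k : ℕ) :
    (∀ y, letter p r x k = Sum.inl y → p^[k] x = y ∧ ¬ ShortCyclic p r y) ∧
      ∀ O t, letter p r x k = Sum.inr (O, t) → ∃ j ≤ k, O = shortOrbit p r (p^[j] x) ∧
        ShortCyclic p r (p^[j] x) := by
  induction k with
  | zero =>
    by_cases hx : ShortCyclic p r x <;>
      simp only [letter, Function.iterate_zero, id, firstLetter, hx, if_true, if_false]
    · exact ⟨by simp, fun O t h => ⟨0, le_rfl, by simp_all⟩⟩
    · exact ⟨fun y h => by simp_all, by simp⟩
  | succ k ih =>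
    rcases hl : letter p r x k with y | ⟨O, t⟩
    · obtain ⟨h1, h2⟩ := ih.1 y hl
      rw [letter_succ, hl, nextLetter]
      have h3 : p^[k + 1] x = p y := by rw [Function.iterate_succ_apply', h1]
      by_cases hy : ShortCyclic p r (p y) <;> simp only [firstLetter, hy, if_true, if_false]
      · exact ⟨by simp, fun O t h => ⟨k + 1, le_rfl, by simp_all⟩⟩
      · exact ⟨fun z h => by simp_all, by simp⟩
    · obtain ⟨j, hj, h⟩ := ih.2 O t hl
      rw [letter_succ, hl, nextLetter]
      exact ⟨by simp, fun O' t' h' => ⟨j, by omega, by simp_all⟩⟩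

theorem letter_injOn (x : X) {a b : ℕ} (hab : a < b) (hb : b < r) :
    letter p r x a ≠ letter p r x b := by
  intro h
  rcases hl : letter p r x a with y | ⟨O, t⟩
  · obtain ⟨h1, h2⟩ := (letter_spec x a).1 y hl
    obtain ⟨h3, -⟩ := (letter_spec x b).1 y (h ▸ hl)
    refine h2 ⟨b - a, by omega, by omega, ?_⟩
    conv_lhs => rw [← h1]
    rw [← Function.iterate_add_apply, Nat.sub_add_cancel hab.le, h3]
  · have h1 := letter_add_of_inr hl (b - a)
    rw [Nat.add_sub_cancel' hab.le, ← h, hl] at h1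
    simp only [Sum.inr.injEq, Prod.mk.injEq, true_and, left_eq_add] at h1
    rw [ZMod.natCast_eq_zero_iff] at h1
    exact absurd (Nat.le_of_dvd (by omega) h1) (by omega)

theorem iterate_eq_of_letter_eq {x y : X} {k l : ℕ} (hk : k < r) (hl : l < r)
    (h : letter p r x k = letter p r y l) :
    ∃ k' < 2 * r, ∃ l' < 2 * r, p^[k'] x = p^[l'] y := by
  rcases hl' : letter p r x k with z | ⟨O, t⟩
  · exact ⟨k, by omega, l, by omega,
      ((letter_spec x k).1 z hl').1.trans ((letter_spec y l).1 z (h ▸ hl')).1.symm⟩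
  · obtain ⟨j, hj, hO, -⟩ := (letter_spec x k).2 O t hl'
    obtain ⟨j', hj', hO', -⟩ := (letter_spec y l).2 O t (h ▸ hl')
    have hmem : p^[j'] y ∈ shortOrbit p r (p^[j] x) := by
      rw [← hO, hO']; exact ⟨0, by omega, rfl⟩
    obtain ⟨a, ha, hay⟩ := hmem
    exact ⟨a + j, by omega, j', by omega, by rw [Function.iterate_add_apply, hay]⟩

open scoped Classical in
theorem card_iterate_preimage_le [Fintype X] {D : ℕ} (hD : ∀ x, #{u | p u = x} ≤ D) (k : ℕ) (x : X) :
    #{u | p^[k] u = x} ≤ D ^ k := by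
  induction k generalizing x with
  | zero =>
    exact card_le_one.2 fun a ha b hb => (mem_filter.1 ha).2.trans (mem_filter.1 hb).2.symm
  | succ k ih =>
    have : ({u | p^[k + 1] u = x} : Finset X) ⊆
        ({w | p w = x} : Finset X).biUnion fun w => ({u | p^[k] u = w} : Finset X) := by
      intro u hu
      simp only [mem_filter, mem_univ, true_and, Function.iterate_succ_apply'] at hu
      simp [hu]
    refine (card_le_card this).trans (card_biUnion_le.trans ?_)
    refine (sum_le_sum fun w _ => ih w).trans ?_
    rw [sum_const, smul_eq_mul, pow_succ']
    exact Nat.mul_le_mul_right _ (hD x)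

open scoped Classical in
theorem card_sharing_letter_le [Fintype X] {D : ℕ} (hD0 : 0 < D) (hD : ∀ x, #{u | p u = x} ≤ D)
    (y : X) :
    #{u | ∃ k < r, ∃ l < r, letter p r u k = letter p r y l} ≤ (2 * r) ^ 2 * D ^ (2 * r) := by
  have : ({u | ∃ k < r, ∃ l < r, letter p r u k = letter p r y l} : Finset X) ⊆
      (range (2 * r) ×ˢ range (2 * r)).biUnion fun a => ({u | p^[a.1] u = p^[a.2] y} : Finset X) := by
    intro u hu
    simp only [mem_filter, mem_univ, true_and] at hu
    obtain ⟨k, hk, l, hl, h⟩ := hu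
    obtain ⟨k', hk', l', hl', h'⟩ := iterate_eq_of_letter_eq hk hl h
    simp only [mem_biUnion, mem_product, mem_range, mem_filter, mem_univ, true_and]
    exact ⟨(k', l'), ⟨hk', hl'⟩, h'⟩
  refine (card_le_card this).trans (card_biUnion_le.trans ?_)
  refine (sum_le_sum (g := fun _ => D ^ (2 * r)) fun a ha => ?_).trans ?_
  · simp only [mem_product, mem_range] at ha
    exact (card_iterate_preimage_le hD _ _).trans (Nat.pow_le_pow_right hD0 ha.1.le)
  · rw [sum_const, card_product, card_range, smul_eq_mul, sq]

end Words

section RandomColoring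

variable {W V A κ : Type*} [Fintype W] [Fintype V] [Fintype A] [Fintype κ] {q : ℕ}

open scoped Classical in
/-- Colourings giving equal colours to two disjoint words make up a `q ^ (-|κ|)` fraction. -/
theorem card_agree_mul_le (σ τ : κ → W) (hσ : Function.Injective σ) (h : ∀ k l, σ k ≠ τ l) :
    #{c : W → Fin q | c ∘ σ = c ∘ τ} * q ^ Fintype.card κ ≤ q ^ Fintype.card W := by
  have hc : #(({c : W → Fin q | c ∘ σ = c ∘ τ} : Finset _) ×ˢ (univ : Finset (κ → Fin q))) =
      #{c : W → Fin q | c ∘ σ = c ∘ τ} * q ^ Fintype.card κ := by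
    rw [card_product]; simp
  rw [← hc, show q ^ Fintype.card W = #(univ : Finset (W → Fin q)) by simp]
  refine card_le_card_of_injOn (fun x => Function.extend σ x.2 x.1) (fun _ _ => mem_univ _) ?_
  rintro ⟨c, y⟩ hx ⟨c', y'⟩ hx' he
  simp only [coe_product, Set.mem_prod, coe_filter, mem_univ, true_and, Set.mem_ofPred_eq, coe_univ,
    Set.mem_univ, and_true] at hx hx' he
  have hy : y = y' := funext fun k => by
    have := congrFun he (σ k)
    rwa [hσ.extend_apply, hσ.extend_apply] at this
  have hoff : ∀ w, (∀ k, σ k ≠ w) → c w = c' w := fun w hw => by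
    have := congrFun he w
    rwa [Function.extend_apply' _ _ _ (by simpa using hw),
      Function.extend_apply' _ _ _ (by simpa using hw)] at this
  refine Prod.ext (funext fun w => ?_) hy
  by_cases hw : ∃ k, σ k = w
  · obtain ⟨k, rfl⟩ := hw
    have h1 := congrFun hx k
    have h2 := congrFun hx' k
    simp only [Function.comp_apply] at h1 h2
    exact h1.trans ((hoff _ fun l => h l k).trans h2.symm)
  · exact hoff w (by simpa using hw)

open scoped Classical in
theorem sum_sq_fiber_sub_mean (hq : 0 < q) (f : V → κ → Fin q) :
    ∑ y, ((#{v | f v = y} : ℝ) - Fintype.card V / q ^ Fintype.card κ) ^ 2 =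
      #{x : V × V | f x.1 = f x.2} - (Fintype.card V : ℝ) ^ 2 / q ^ Fintype.card κ := by
  have h1 : ∑ y, (#{v | f v = y} : ℝ) = Fintype.card V := by
    rw [← card_univ, card_eq_sum_card_fiberwise (f := f) (t := univ) (by simp)]
    push_cast; rfl
  have h2 : ∑ y, (#{v | f v = y} : ℝ) ^ 2 = #{x : V × V | f x.1 = f x.2} := by
    rw [card_eq_sum_card_fiberwise (f := fun x => f x.1) (t := univ) (by simp)]
    push_cast
    refine sum_congr rfl fun y _ => ?_
    rw [sq, ← Nat.cast_mul, ← card_product]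
    congr 2
    ext ⟨a, b⟩
    simp only [mem_product, mem_filter, mem_univ, true_and]
    constructor
    · rintro ⟨rfl, h⟩; exact ⟨h.symm, rfl⟩
    · rintro ⟨h, rfl⟩; exact ⟨rfl, h.symm⟩
  have h3 : ∑ _y : κ → Fin q, (Fintype.card V / (q : ℝ) ^ Fintype.card κ) ^ 2 =
      (Fintype.card V : ℝ) ^ 2 / q ^ Fintype.card κ := by
    rw [sum_const, card_univ, Fintype.card_fun, Fintype.card_fin, nsmul_eq_mul]
    push_cast
    have : (q : ℝ) ^ Fintype.card κ ≠ 0 := by positivity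
    field_simp
  simp only [sub_sq, sum_add_distrib, sum_sub_distrib]
  rw [h2, h3, ← sum_mul, ← mul_sum, h1]
  ring

open scoped Classical in
theorem sum_card_agree_le (hq : 0 < q) (σ : V → κ → W) (hσ : ∀ v, Function.Injective (σ v)) {D : ℕ}
    (hD : ∀ v, #{u | ∃ k l, σ u k = σ v l} ≤ D) :
    ∑ c : W → Fin q, (#{x : V × V | c ∘ σ x.1 = c ∘ σ x.2} : ℝ) ≤
      (q : ℝ) ^ Fintype.card W *
        ((Fintype.card V : ℝ) ^ 2 / q ^ Fintype.card κ + Fintype.card V * D) := by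
  have hswap : ∑ c : W → Fin q, #{x : V × V | c ∘ σ x.1 = c ∘ σ x.2} =
      ∑ x : V × V, #{c : W → Fin q | c ∘ σ x.1 = c ∘ σ x.2} :=
    sum_card_bipartiteAbove_eq_sum_card_bipartiteBelow
      (fun (c : W → Fin q) (x : V × V) => c ∘ σ x.1 = c ∘ σ x.2)
  have hq' : (0 : ℝ) < (q : ℝ) ^ Fintype.card κ := by positivity
  have hpt : ∀ x : V × V, (#{c : W → Fin q | c ∘ σ x.1 = c ∘ σ x.2} : ℝ) ≤
      (q : ℝ) ^ Fintype.card W * (1 / q ^ Fintype.card κ +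
        if ∃ k l, σ x.1 k = σ x.2 l then 1 else 0) := by
    intro x
    split_ifs with h
    · have : #{c : W → Fin q | c ∘ σ x.1 = c ∘ σ x.2} ≤ q ^ Fintype.card W :=
        (card_le_univ _).trans (by simp)
      have : (#{c : W → Fin q | c ∘ σ x.1 = c ∘ σ x.2} : ℝ) ≤ (q : ℝ) ^ Fintype.card W := by
        exact_mod_cast this
      refine this.trans (le_mul_of_one_le_right (by positivity) ?_)
      have : 0 ≤ 1 / (q : ℝ) ^ Fintype.card κ := by positivity
      linarith
    · push Not at h
      have := card_agree_mul_le (q := q) (σ x.1) (σ x.2) (hσ _) h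
      rw [add_zero, mul_one_div, le_div_iff₀ hq']
      exact_mod_cast this
  have hpairs : (∑ x : V × V, if ∃ k l, σ x.1 k = σ x.2 l then (1 : ℝ) else 0) ≤
      Fintype.card V * D := by
    rw [Fintype.sum_prod_type_right]
    calc _ ≤ ∑ _v : V, (D : ℝ) := sum_le_sum fun v _ => by
          rw [sum_boole]; exact_mod_cast hD v
      _ = _ := by simp
  calc _ = ((∑ c : W → Fin q, #{x : V × V | c ∘ σ x.1 = c ∘ σ x.2} : ℕ) : ℝ) := by push_cast; rfl
    _ = ∑ x : V × V, (#{c : W → Fin q | c ∘ σ x.1 = c ∘ σ x.2} : ℝ) := by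
      rw [hswap]; push_cast; rfl
    _ ≤ ∑ x : V × V, (q : ℝ) ^ Fintype.card W * (1 / q ^ Fintype.card κ +
        if ∃ k l, σ x.1 k = σ x.2 l then 1 else 0) := sum_le_sum fun x _ => hpt x
    _ ≤ _ := by
      rw [← mul_sum, sum_add_distrib, sum_const, card_univ, Fintype.card_prod, nsmul_eq_mul]
      refine mul_le_mul_of_nonneg_left (add_le_add (le_of_eq ?_) hpairs) (by positivity)
      push_cast
      ring

open scoped Classical in
/-- Some colouring spreads all the word systems `σ a` almost evenly over `κ → Fin q`. -/
theorem exists_coloring_fiber_le (hq : 0 < q) (σ : A → V → κ → W)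
    (hσ : ∀ a v, Function.Injective (σ a v)) {D : ℕ}
    (hD : ∀ a v, #{u | ∃ k l, σ a u k = σ a v l} ≤ D) :
    ∃ c : W → Fin q, ∀ a y, (#{v | c ∘ σ a v = y} : ℝ) ≤
      Fintype.card V / q ^ Fintype.card κ + √(Fintype.card A * (Fintype.card V * D)) := by
  have : NeZero q := ⟨hq.ne'⟩
  let dev : (W → Fin q) → A → ℝ := fun c a =>
    ∑ y, ((#{v | c ∘ σ a v = y} : ℝ) - Fintype.card V / q ^ Fintype.card κ) ^ 2
  obtain ⟨c, -, hc⟩ : ∃ c ∈ (univ : Finset (W → Fin q)),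
      ∑ a, dev c a ≤ Fintype.card A * (Fintype.card V * D) := by
    refine exists_le_of_sum_le ⟨fun _ => 0, mem_univ _⟩ ?_
    rw [sum_comm, sum_const, card_univ, Fintype.card_fun, Fintype.card_fin, nsmul_eq_mul]
    calc _ ≤ ∑ _a : A, (q : ℝ) ^ Fintype.card W * (Fintype.card V * D) := sum_le_sum fun a _ => by
          simp only [dev]
          rw [sum_congr rfl fun c _ => sum_sq_fiber_sub_mean hq fun v => c ∘ σ a v,
            sum_sub_distrib, sum_const, card_univ, Fintype.card_fun, Fintype.card_fin, nsmul_eq_mul]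
          have := sum_card_agree_le (q := q) hq (σ a) (hσ a) (hD a)
          push_cast
          linarith
      _ = _ := by
        rw [sum_const, card_univ, nsmul_eq_mul]
        push_cast
        ring
  refine ⟨c, fun a y => ?_⟩
  have h1 : ((#{v | c ∘ σ a v = y} : ℝ) - Fintype.card V / q ^ Fintype.card κ) ^ 2 ≤ dev c a :=
    single_le_sum (f := fun y => ((#{v | c ∘ σ a v = y} : ℝ) -
      Fintype.card V / q ^ Fintype.card κ) ^ 2) (fun _ _ => sq_nonneg _) (mem_univ y)
  have h2 : dev c a ≤ ∑ a, dev c a :=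
    single_le_sum (f := dev c) (fun a _ => sum_nonneg fun _ _ => sq_nonneg _) (mem_univ a)
  have := Real.le_sqrt_of_sq_le (h1.trans (h2.trans hc))
  linarith

end RandomColoring

section Contraction

variable [Fintype V] [DecidableEq V] {G : SimpleGraph V} {w : ℕ}

/-- `P` can be contracted to at most one part through partitions of quotient degree at most `w`. -/
def Contractible (G : SimpleGraph V) (w : ℕ) (P : Finpartition (univ : Finset V)) : Prop :=
  ∃ n : ℕ, ∃ S : Fin (n + 1) → Finpartition (univ : Finset V),
    S 0 = P ∧ (S (Fin.last n)).parts.card ≤ 1 ∧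
    (∀ i : Fin n, IsMergeStep (S i.castSucc) (S i.succ)) ∧
    (∀ i, ∀ A ∈ (S i).parts, quotDeg G (S i) A ≤ w)

/-- The parts of `P` are the fibres of `h`. -/
def IsKernel {Y : Type*} (P : Finpartition (univ : Finset V)) (h : V → Y) : Prop :=
  ∀ u v, v ∈ P.part u ↔ h u = h v

theorem Contractible.of_card_le_one {P : Finpartition (univ : Finset V)} (hP : P.parts.card ≤ 1) :
    Contractible G w P := by
  refine ⟨0, fun _ => P, rfl, hP, fun i => i.elim0, fun _ A hA => ?_⟩
  have : IsEmpty {B : Finset V // B ∈ P.parts ∧ B ≠ A ∧ ∃ u ∈ A, ∃ v ∈ B, G.Adj u v} :=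
    ⟨fun B => B.2.2.1 (card_le_one.1 hP _ B.2.1 _ hA)⟩
  rw [quotDeg, Nat.card_of_isEmpty]
  exact Nat.zero_le _

theorem Contractible.of_mergeStep {P Q : Finpartition (univ : Finset V)} (hPQ : IsMergeStep P Q)
    (hP : ∀ A ∈ P.parts, quotDeg G P A ≤ w) (hQ : Contractible G w Q) : Contractible G w P := by
  obtain ⟨n, S, hS0, hS1, hS2, hS3⟩ := hQ
  refine ⟨n + 1, Fin.cons P S, rfl, ?_, fun i => ?_, fun i => ?_⟩
  · rwa [← Fin.succ_last, Fin.cons_succ]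
  · refine Fin.cases ?_ (fun i => ?_) i
    · rw [Fin.castSucc_zero, Fin.cons_zero, Fin.cons_succ, hS0]; exact hPQ
    · rw [← Fin.succ_castSucc, Fin.cons_succ, Fin.cons_succ]; exact hS2 i
  · refine Fin.cases ?_ (fun i => ?_) i
    · simpa using hP
    · simpa using hS3 i

theorem exists_mergeStep {P : Finpartition (univ : Finset V)} {A B : Finset V} (hA : A ∈ P.parts)
    (hB : B ∈ P.parts) :
    ∃ Q : Finpartition (univ : Finset V), Q.parts = insert (A ∪ B) ((P.parts.erase A).erase B) := by
  refine ⟨⟨insert (A ∪ B) ((P.parts.erase A).erase B), ?_, ?_, ?_⟩, rfl⟩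
  · rw [supIndep_iff_pairwiseDisjoint]
    have hdis : ∀ C ∈ (P.parts.erase A).erase B, Disjoint (A ∪ B) C := fun C hC => by
      simp only [mem_erase] at hC
      rw [disjoint_union_left]
      exact ⟨P.disjoint hA hC.2.2 hC.2.1.symm, P.disjoint hB hC.2.2 hC.1.symm⟩
    intro C hC D hD hCD
    simp only [coe_insert, Set.mem_insert_iff, mem_coe] at hC hD
    rcases hC with rfl | hC <;> rcases hD with rfl | hD
    · exact absurd rfl hCD
    · exact hdis D hD
    · exact (hdis C hC).symm
    · simp only [mem_erase] at hC hD
      exact P.disjoint hC.2.2 hD.2.2 hCD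
  · refine eq_univ_iff_forall.2 fun v => ?_
    obtain ⟨C, hC, hv⟩ := P.exists_mem (mem_univ v)
    rw [mem_sup]
    by_cases hCA : C = A
    · exact ⟨A ∪ B, mem_insert_self _ _, mem_union_left _ (hCA ▸ hv)⟩
    by_cases hCB : C = B
    · exact ⟨A ∪ B, mem_insert_self _ _, mem_union_right _ (hCB ▸ hv)⟩
    exact ⟨C, mem_insert_of_mem (mem_erase.2 ⟨hCB, mem_erase.2 ⟨hCA, hC⟩⟩), hv⟩
  · simp only [mem_insert, mem_erase, not_or]
    refine ⟨fun h => ?_, fun h => P.bot_notMem h.2.2⟩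
    obtain ⟨v, hv⟩ := P.nonempty_of_mem_parts hA
    have : v ∈ (⊥ : Finset V) := h ▸ mem_union_left B hv
    simp at this

open scoped Classical in
/-- If `P` refines the fibres of `h`, and no fibre of `h` sees more than `w` parts of `P`, then `P`
can be contracted to the partition into fibres of `h`. -/
theorem Contractible.of_refines {Y : Type*} {h : V → Y} {P : Finpartition (univ : Finset V)}
    (hP : ∀ A ∈ P.parts, ∀ u ∈ A, ∀ v ∈ A, h u = h v)
    (hw : ∀ y, #{A ∈ P.parts | ∃ u, h u = y ∧ ∃ v ∈ A, G.Adj u v} ≤ w)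
    (hQ : ∀ Q : Finpartition (univ : Finset V), IsKernel Q h → Contractible G w Q) :
    Contractible G w P := by
  induction hn : #P.parts generalizing P with
  | zero => exact .of_card_le_one (by omega)
  | succ n ih =>
    by_cases hker : ∀ A ∈ P.parts, ∀ B ∈ P.parts, ∀ u ∈ A, ∀ v ∈ B, h u = h v → A = B
    · refine hQ P fun u v => ⟨fun huv => ?_, fun huv => ?_⟩
      · exact hP _ (P.part_mem.2 (mem_univ u)) u (P.mem_part (mem_univ u)) v huv
      · rw [hker _ (P.part_mem.2 (mem_univ u)) _ (P.part_mem.2 (mem_univ v)) u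
          (P.mem_part (mem_univ u)) v (P.mem_part (mem_univ v)) huv]
        exact P.mem_part (mem_univ v)
    push Not at hker
    obtain ⟨A, hA, B, hB, a, ha, b, hb, hab, hne⟩ := hker
    obtain ⟨Q, hQparts⟩ := exists_mergeStep hA hB
    have hone : 1 < #P.parts := one_lt_card.2 ⟨A, hA, B, hB, hne⟩
    refine .of_mergeStep (Q := Q) ⟨A, hA, B, hB, hne, hQparts⟩ (fun C hC => ?_) ?_
    · obtain ⟨c, hc⟩ := P.nonempty_of_mem_parts hC
      refine le_trans ?_ (hw (h c))
      rw [quotDeg, Nat.subtype_card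
        {D ∈ P.parts | D ≠ C ∧ ∃ u ∈ C, ∃ v ∈ D, G.Adj u v} (by simp)]
      refine card_le_card fun D hD => ?_
      simp only [mem_filter] at hD ⊢
      obtain ⟨hD, -, u, hu, v, hv, huv⟩ := hD
      exact ⟨hD, u, hP C hC u hu c hc, v, hv, huv⟩
    · have hcard : #Q.parts = n := by
        rw [hQparts, card_insert_of_notMem, card_erase_of_mem (mem_erase.2 ⟨hne.symm, hB⟩),
          card_erase_of_mem hA]
        · omega
        · intro hmem
          simp only [mem_erase] at hmem
          exact disjoint_left.1 (P.disjoint hmem.2.2 hA hmem.2.1) (mem_union_left B ha) ha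
      refine ih (fun C hC u hu v hv => ?_) (fun y => le_trans ?_ (hw y)) hcard
      · rw [hQparts, mem_insert] at hC
        rcases hC with rfl | hC
        · have key : ∀ x ∈ A ∪ B, h x = h a := fun x hx => by
            rcases mem_union.1 hx with hx | hx
            · exact hP A hA x hx a ha
            · exact (hP B hB x hx b hb).trans hab.symm
          exact (key u hu).trans (key v hv).symm
        · exact hP C (mem_of_mem_erase (mem_of_mem_erase hC)) u hu v hv
      · let f : Finset V → Finset V := fun C => if C = A ∨ C = B then A ∪ B else C
        refine (card_le_card (t := image f _) fun C hC => ?_).trans card_image_le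
        simp only [mem_filter, hQparts, mem_insert, mem_erase] at hC
        obtain ⟨hC, u, hu, v, hv, huv⟩ := hC
        simp only [mem_image, mem_filter]
        rcases hC with rfl | ⟨hCB, hCA, hC⟩
        · rcases mem_union.1 hv with hv | hv
          · exact ⟨A, ⟨hA, u, hu, v, hv, huv⟩, by simp [f]⟩
          · exact ⟨B, ⟨hB, u, hu, v, hv, huv⟩, by simp [f]⟩
        · exact ⟨C, ⟨hC, u, hu, v, hv, huv⟩, by simp [f, hCA, hCB]⟩

open scoped Classical in
theorem Contractible.of_kernel_refines {X Y : Type*} {g : V → X} {h : V → Y}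
    (hgh : ∀ u v, g u = g v → h u = h v)
    (hw : ∀ y, #(image g {v | ∃ u, h u = y ∧ G.Adj u v}) ≤ w)
    (hQ : ∀ Q : Finpartition (univ : Finset V), IsKernel Q h → Contractible G w Q)
    (P : Finpartition (univ : Finset V)) (hP : IsKernel P g) : Contractible G w P := by
  refine .of_refines (h := h) (fun A hA u hu v hv => hgh u v ?_) (fun y => ?_) hQ
  · rw [← hP, P.part_eq_of_mem hA hu]; exact hv
  · refine le_trans ?_ (hw y)
    have hfac : Function.FactorsThrough P.part g := fun u v huv =>
      (P.part_eq_of_mem (P.part_mem.2 (mem_univ u)) ((hP u v).2 huv)).symm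
    refine (card_le_card (t := image (Function.extend g P.part fun _ => ∅) _)
      fun A hA => ?_).trans card_image_le
    obtain ⟨hA, u, hu, v, hv, huv⟩ := mem_filter.1 hA
    rw [image_image, mem_image]
    exact ⟨v, by simpa using ⟨u, hu, huv⟩, by
      rw [Function.comp_apply, hfac.extend_apply, P.part_eq_of_mem hA hv]⟩

theorem tww_le_of_contractible (h : ∀ P : Finpartition (univ : Finset V),
    IsKernel P id → Contractible G w P) : tww G ≤ w := by
  have hbot : IsKernel (⊥ : Finpartition (univ : Finset V)) id := fun u v => by
    obtain ⟨x, -, hx⟩ := Finpartition.mem_bot_iff.1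
      ((⊥ : Finpartition (univ : Finset V)).part_mem.2 (mem_univ u))
    have hu := (⊥ : Finpartition (univ : Finset V)).mem_part (mem_univ u)
    rw [← hx, mem_singleton] at hu
    rw [← hx, mem_singleton, hu, id, id, eq_comm]
  obtain ⟨n, S, hS0, hS1, hS2, hS3⟩ := h _ hbot
  refine Nat.sInf_le ⟨n, S, fun A hA => ?_, hS1, hS2, fun i A hA => le_trans ?_ (hS3 i A hA)⟩
  · rw [hS0, Finpartition.mem_bot_iff] at hA
    obtain ⟨x, -, rfl⟩ := hA
    exact card_singleton x
  · refine Nat.card_mono (Set.toFinite _) fun B hB => ?_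
    exact ⟨hB.1, hB.2.1, hB.2.2.1⟩

end Contraction

section ColoredWords

/-- One of the sequences `x`, `y` is equal to the other one or is obtained by deleting its first
entry. -/
def ShiftRelated {α : Type*} (x y : ℕ → α) : Prop :=
  (∀ k, y k = x k) ∨ (∀ k, y k = x (k + 1)) ∨ ∀ k, x k = y (k + 1)

open scoped Classical in
theorem exists_colored_words [Fintype V] {G : SimpleGraph V} {d : ℕ} (hd : 2 < d) (hG : IsReg G d)
    {q : ℕ} (hq : 0 < q) (r : ℕ) :
    ∃ F : V → Fin d → ℕ → Fin q,
      (∀ u v, G.Adj u v → ∃ i j, i ≠ j ∧ ShiftRelated (F u i) (F v i) ∧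
        ShiftRelated (F u j) (F v j)) ∧
      ∀ i j, i ≠ j → ∀ a b : Fin r → Fin q,
        (#{v | (∀ k : Fin r, F v i k = a k) ∧ ∀ k : Fin r, F v j k = b k} : ℝ) ≤
          Fintype.card V / q ^ (2 * r) +
            √(d ^ 2 * (Fintype.card V * (2 * ((2 * r) ^ 2 * (d + 1) ^ (2 * r))))) := by
  obtain ⟨p, hp, hadj⟩ := exists_neighborMaps hd hG
  let A := {x : Fin d × Fin d // x.1 ≠ x.2}
  let : Fintype (Fin d × (V ⊕ (Set V × ZMod (r + 1)))) := Fintype.ofFinite _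
  let σ : A → V → Fin r ⊕ Fin r → Fin d × (V ⊕ (Set V × ZMod (r + 1))) := fun a v =>
    Sum.elim (fun k => (a.1.1, letter (p a.1.1) r v k)) fun k => (a.1.2, letter (p a.1.2) r v k)
  have hinj : ∀ i v, Function.Injective fun k : Fin r => letter (p i) r v k := by
    intro i v
    exact Function.Injective.of_lt_imp_ne fun a b hab => letter_injOn v hab b.2
  have hσ : ∀ a v, Function.Injective (σ a v) := by
    intro a v
    refine Function.Injective.sumElim (fun k l h => hinj _ v (Prod.ext_iff.1 h).2)
      (fun k l h => hinj _ v (Prod.ext_iff.1 h).2) fun k l h => a.2 (Prod.ext_iff.1 h).1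
  have hshare : ∀ i v, #{u | ∃ k < r, ∃ l < r, letter (p i) r u k = letter (p i) r v l} ≤
      (2 * r) ^ 2 * (d + 1) ^ (2 * r) := fun i v =>
    card_sharing_letter_le (Nat.succ_pos d)
      (fun x => by convert card_preimage_neighborMap_le hG (hp i) x) v
  have hD : ∀ a v, #{u | ∃ k l, σ a u k = σ a v l} ≤ 2 * ((2 * r) ^ 2 * (d + 1) ^ (2 * r)) := by
    intro a v
    rw [two_mul (_ * _)]
    refine le_trans (card_le_card ?_) ((card_union_le _ _).trans
      (add_le_add (hshare a.1.1 v) (hshare a.1.2 v)))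
    intro u hu
    obtain ⟨k, l, h⟩ := (mem_filter.1 hu).2
    simp only [mem_union, mem_filter, mem_univ, true_and]
    rcases k with k | k <;> rcases l with l | l
    · exact Or.inl ⟨k, k.2, l, l.2, (Prod.ext_iff.1 h).2⟩
    · exact absurd (Prod.ext_iff.1 h).1 a.2
    · exact absurd (Prod.ext_iff.1 h).1.symm a.2
    · exact Or.inr ⟨k, k.2, l, l.2, (Prod.ext_iff.1 h).2⟩
  obtain ⟨c, hc⟩ := exists_coloring_fiber_le hq σ hσ fun a v => by convert hD a v
  have hshift : ∀ i u v, p i u = v ∨ p i v = u →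
      ShiftRelated (fun k => c (i, letter (p i) r u k)) fun k => c (i, letter (p i) r v k) := by
    rintro i u v (rfl | rfl)
    · rcases letter_map (p := p i) (r := r) u with h | h
      · exact Or.inl fun k => congrArg (fun x => c (i, x)) (h k)
      · exact Or.inr (Or.inl fun k => congrArg (fun x => c (i, x)) (h k))
    · rcases letter_map (p := p i) (r := r) v with h | h
      · exact Or.inl fun k => congrArg (fun x => c (i, x)) (h k).symm
      · exact Or.inr (Or.inr fun k => congrArg (fun x => c (i, x)) (h k))
  refine ⟨fun v i k => c (i, letter (p i) r v k), fun u v huv => ?_, fun i j hij a b => ?_⟩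
  · obtain ⟨i, j, hij, hi, hj⟩ := hadj u v huv
    exact ⟨i, j, hij, hshift i u v hi, hshift j u v hj⟩
  · refine (Nat.cast_le.2 (card_le_card fun v hv => ?_)).trans
      ((hc ⟨(i, j), hij⟩ (Sum.elim a b)).trans
        (add_le_add (le_of_eq ?_) (Real.sqrt_le_sqrt ?_)))
    · simpa [σ, funext_iff] using hv
    · simp [two_mul]
    · push_cast
      refine mul_le_mul_of_nonneg_right ?_ (by positivity)
      have : Fintype.card A ≤ d ^ 2 := by
        refine (Fintype.card_subtype_le _).trans ?_
        simp [sq]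
      exact_mod_cast this

end ColoredWords

section Levels

variable {q d : ℕ}

/-- The transitions available between the word systems of adjacent vertices. -/
abbrev Transition (d q : ℕ) : Type := (Fin d × Fin d) × (Fin 3 × Fin q) × (Fin 3 × Fin q)

/-- The transitions acting on two different coordinates. -/
def transitions (d q : ℕ) : Finset (Transition d q) := univ.offDiag ×ˢ univ

theorem card_transitions_le : #(transitions d q) ≤ d ^ 2 * (3 * q) ^ 2 := by
  rw [transitions, card_product, offDiag_card]
  simp only [card_univ, Fintype.card_fin, Fintype.card_prod]
  rw [sq (3 * q), sq d]
  exact Nat.mul_le_mul_right _ (Nat.sub_le _ _)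

variable [NeZero q]

/-- The word agreeing with `x` in the first `l` places and zero afterwards. -/
def truncate (l : ℕ) (x : ℕ → Fin q) (k : ℕ) : Fin q := if k < l then x k else 0

/-- The three ways to obtain a truncated word from a truncated word shift related to it; the letter
`s.2` is the one not occurring in `x`. -/
def shiftBy (l : ℕ) (x : ℕ → Fin q) (s : Fin 3 × Fin q) : ℕ → Fin q :=
  if s.1 = 0 then x
  else if s.1 = 1 then fun k => if k + 1 < l then x (k + 1) else if k < l then s.2 else 0
  else fun k => if l ≤ k then 0 else if k = 0 then s.2 else x (k - 1)

theorem ShiftRelated.exists_shiftBy {x y : ℕ → Fin q} (h : ShiftRelated x y) (l : ℕ) :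
    ∃ s, truncate l y = shiftBy l (truncate l x) s := by
  rcases h with h | h | h
  · exact ⟨(0, 0), funext fun k => by simp [truncate, shiftBy, h]⟩
  · refine ⟨(1, x l), funext fun k => ?_⟩
    simp only [truncate, shiftBy, h]
    grind
  · refine ⟨(2, y 0), funext fun k => ?_⟩
    simp only [truncate, shiftBy, h]
    rcases k with _ | k <;> grind

/-- The system of truncations of the words `x i` to lengths `l i`. -/
def truncateAll (l : Fin d → ℕ) (x : Fin d → ℕ → Fin q) : Fin d → ℕ → Fin q :=
  fun i => truncate (l i) (x i)

variable {F : V → Fin d → ℕ → Fin q}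

theorem exists_transition {u v : V}
    (huv : ∃ i j, i ≠ j ∧ ShiftRelated (F u i) (F v i) ∧ ShiftRelated (F u j) (F v j))
    (l : Fin d → ℕ) :
    ∃ t ∈ transitions d q,
      truncateAll l (F v) t.1.1 = shiftBy (l t.1.1) (truncateAll l (F u) t.1.1) t.2.1 ∧
      truncateAll l (F v) t.1.2 = shiftBy (l t.1.2) (truncateAll l (F u) t.1.2) t.2.2 := by
  obtain ⟨i, j, hij, hi, hj⟩ := huv
  obtain ⟨s, hs⟩ := hi.exists_shiftBy (l i)
  obtain ⟨t, ht⟩ := hj.exists_shiftBy (l j)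
  exact ⟨((i, j), s, t), by simpa [transitions] using hij, hs, ht⟩

variable [Fintype V] {G : SimpleGraph V}

open scoped Classical in
theorem card_image_truncateAll_le
    (hF : ∀ u v, G.Adj u v →
      ∃ i j, i ≠ j ∧ ShiftRelated (F u i) (F v i) ∧ ShiftRelated (F u j) (F v j))
    {r : ℕ} {l : Fin d → ℕ} (hl : ∀ i, l i ≤ r) (y : Fin d → ℕ → Fin q) :
    #(image (fun v => truncateAll l (F v)) {v | ∃ u, truncateAll l (F u) = y ∧ G.Adj u v}) ≤
      d ^ 2 * (3 * q) ^ 2 * (q ^ r) ^ (d - 2) := by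
  let Z : (t : Transition d q) → (Fin d → Fin r → Fin q) → Fin d → ℕ → Fin q := fun t z k =>
    if k = t.1.1 then shiftBy (l k) (y k) t.2.1
    else if k = t.1.2 then shiftBy (l k) (y k) t.2.2
    else fun m => if h : m < r then z k ⟨m, h⟩ else 0
  let T : (t : Transition d q) → Finset (Fin d → Fin r → Fin q) := fun t =>
    Fintype.piFinset fun k => if k = t.1.1 ∨ k = t.1.2 then {0} else univ
  have hT : ∀ t ∈ transitions d q, #(T t) = (q ^ r) ^ (d - 2) := by
    intro t ht
    have hne : t.1.1 ≠ t.1.2 := by simpa [transitions] using ht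
    simp only [T, Fintype.card_piFinset, apply_ite Finset.card, card_singleton, card_univ,
      Fintype.card_fun, Fintype.card_fin]
    rw [prod_ite, prod_const_one, one_mul, prod_const]
    congr 1
    have : ({k | ¬ (k = t.1.1 ∨ k = t.1.2)} : Finset (Fin d)) = {t.1.1, t.1.2}ᶜ := by
      ext k; simp
    rw [this, card_compl, card_pair hne, Fintype.card_fin]
  have hsub : image (fun v => truncateAll l (F v))
      ({v | ∃ u, truncateAll l (F u) = y ∧ G.Adj u v} : Finset V) ⊆
      (transitions d q).biUnion fun t => image (Z t) (T t) := by
    intro x hx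
    obtain ⟨v, hv, rfl⟩ := mem_image.1 hx
    obtain ⟨u, rfl, huv⟩ := (mem_filter.1 hv).2
    obtain ⟨t, ht, h1, h2⟩ := exists_transition (hF u v huv) l
    refine mem_biUnion.2 ⟨t, ht, mem_image.2 ⟨fun k m =>
      if k = t.1.1 ∨ k = t.1.2 then 0 else truncateAll l (F v) k m, ?_, ?_⟩⟩
    · simp only [T, Fintype.mem_piFinset]
      intro k
      split_ifs with h
      · simp only [mem_singleton]; rfl
      · exact mem_univ _
    · funext k
      by_cases hk1 : k = t.1.1
      · simp only [Z, if_pos hk1]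
        rw [hk1, h1]
      by_cases hk2 : k = t.1.2
      · simp only [Z, if_neg hk1, if_pos hk2]
        rw [hk2, h2]
      funext m
      by_cases hm : m < r
      · simp [Z, hk1, hk2, hm]
      · have hlm : ¬m < l k := fun h => hm (h.trans_le (hl k))
        simp [Z, hk1, hk2, hm, truncateAll, truncate, hlm]
  refine (card_le_card hsub).trans (card_biUnion_le.trans ?_)
  refine (sum_le_sum fun t ht => card_image_le.trans (hT t ht).le).trans ?_
  rw [sum_const, smul_eq_mul]
  exact Nat.mul_le_mul_right _ card_transitions_le

theorem truncateAll_truncateAll {l' l : Fin d → ℕ} (h : l' ≤ l) (x : Fin d → ℕ → Fin q) :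
    truncateAll l' (truncateAll l x) = truncateAll l' x := by
  funext i k
  have := h i
  simp only [truncateAll, truncate]
  grind

open scoped Classical in
theorem Contractible.of_kernel_truncateAll [DecidableEq V]
    (hF : ∀ u v, G.Adj u v →
      ∃ i j, i ≠ j ∧ ShiftRelated (F u i) (F v i) ∧ ShiftRelated (F u j) (F v j))
    {r w : ℕ} (hw : q * (d ^ 2 * (3 * q) ^ 2 * (q ^ r) ^ (d - 2)) ≤ w)
    (l : Fin d → ℕ) (hl : ∀ i, l i ≤ r) (P : Finpartition (univ : Finset V))
    (hP : IsKernel P fun v => truncateAll l (F v)) : Contractible G w P := by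
  induction hn : ∑ i, l i generalizing l P with
  | zero =>
    have hl0 : ∀ i, l i = 0 := by simpa using hn
    refine .of_card_le_one (card_le_one.2 fun A hA B hB => ?_)
    obtain ⟨u, hu⟩ := P.nonempty_of_mem_parts hA
    obtain ⟨v, hv⟩ := P.nonempty_of_mem_parts hB
    have huv : v ∈ P.part u := (hP u v).2 (by funext i k; simp [truncateAll, truncate, hl0])
    rw [P.part_eq_of_mem hA hu] at huv
    exact P.eq_of_mem_parts hA hB huv hv
  | succ n ih =>
    obtain ⟨i, -, hi⟩ : ∃ i ∈ univ, l i ≠ 0 := by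
      by_contra! h
      rw [sum_eq_zero h] at hn
      omega
    obtain ⟨m, hm⟩ := Nat.exists_eq_succ_of_ne_zero hi
    have hle : Function.update l i m ≤ l := update_le_self_iff.2 (by omega)
    refine .of_kernel_refines (h := fun v => truncateAll (Function.update l i m) (F v))
      (fun u v huv => ?_) (fun y => ?_)
      (fun Q hQ => ih _ (fun j => (hle j).trans (hl j)) Q hQ ?_) P hP
    · rw [← truncateAll_truncateAll hle (F u), huv, truncateAll_truncateAll hle]
    · refine le_trans ?_ hw
      refine le_trans (card_le_card (t := (univ : Finset (Fin q)).biUnion fun a =>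
        image (fun v => truncateAll l (F v)) {v | ∃ u, truncateAll l (F u) =
          Function.update y i (Function.update (y i) m a) ∧ G.Adj u v}) fun x hx => ?_) ?_
      · simp only [mem_image, mem_filter, mem_univ, true_and, mem_biUnion] at hx ⊢
        obtain ⟨v, ⟨u, rfl, huv⟩, rfl⟩ := hx
        refine ⟨F u i m, v, ⟨u, ?_, huv⟩, rfl⟩
        funext j k
        by_cases hj : j = i
        · subst hj
          simp only [truncateAll, truncate, Function.update_self, hm, Function.update_apply]
          grind
        · simp [truncateAll, hj]
      · refine card_biUnion_le.trans ((sum_le_sum fun a _ =>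
          card_image_truncateAll_le hF hl _).trans ?_)
        simp
    · rw [← Finset.add_sum_erase _ _ (mem_univ i)] at hn ⊢
      rw [Function.update_self, sum_congr rfl fun j hj =>
        Function.update_of_ne (ne_of_mem_erase hj) _ _]
      omega

end Levels

section Refinement

variable [Fintype V]

open scoped Classical in
/-- The fibres of a map can be subdivided into classes of size at most `K`, with only one class
smaller than `K` in each fibre. -/
theorem exists_subdivision {Y : Type*} (h : V → Y) {K : ℕ} (hK : 0 < K) :
    ∃ ρ : V → ℕ, (∀ c : Y × ℕ, #{v | (h v, ρ v) = c} ≤ K) ∧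
      ∀ S : Finset Y, (#(image (fun v => (h v, ρ v)) {v | h v ∈ S}) : ℝ) ≤
        #S + (#{v | h v ∈ S} : ℝ) / K := by
  let e : ∀ y, {v // h v = y} ≃ Fin (Fintype.card {v // h v = y}) := fun y =>
    Fintype.equivFin {v // h v = y}
  let rank : V → ℕ := fun v => e (h v) ⟨v, rfl⟩
  have hrank : ∀ y v (hv : h v = y), rank v = e y ⟨v, hv⟩ := by
    rintro _ v rfl
    rfl
  have hlt : ∀ v, rank v < #{u | h u = h v} := fun v => by
    rw [← Fintype.card_subtype]
    exact (e (h v) ⟨v, rfl⟩).2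
  refine ⟨fun v => rank v / K, fun c => ?_, fun S => ?_⟩
  · have hI : #(Ico (K * c.2) (K * c.2 + K)) = K := by simp
    refine le_trans ?_ hI.le
    refine card_le_card_of_injOn rank (fun v hv => ?_) fun u hu v hv huv => ?_
    · obtain rfl := (mem_filter.1 hv).2
      simp only [coe_Ico, Set.mem_Ico]
      exact ⟨Nat.mul_div_le _ _, Nat.lt_mul_div_succ _ hK⟩
    · obtain rfl := (mem_filter.1 hv).2
      have hh : h u = h v := (Prod.ext_iff.1 (mem_filter.1 hu).2).1
      rw [hrank _ u hh, hrank _ v rfl, Fin.val_inj, (e _).apply_eq_iff_eq] at huv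
      exact (Subtype.ext_iff.1 huv)
  · have hsub : image (fun v => (h v, rank v / K)) ({v | h v ∈ S} : Finset V) ⊆
        S.biUnion fun y => image (Prod.mk y) (range (#{u | h u = y} / K + 1)) := by
      intro x hx
      obtain ⟨v, hv, rfl⟩ := mem_image.1 hx
      refine mem_biUnion.2 ⟨h v, (mem_filter.1 hv).2, mem_image.2 ⟨_, mem_range.2 ?_, rfl⟩⟩
      exact Nat.lt_succ_of_le (Nat.div_le_div_right (hlt v).le)
    have hsum : (#{v | h v ∈ S} : ℝ) = ∑ y ∈ S, (#{u | h u = y} : ℝ) := by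
      rw [← Nat.cast_sum, card_eq_sum_card_fiberwise (f := h) (t := S) fun v hv => by simpa using hv]
      refine congrArg _ (sum_congr rfl fun y hy => congrArg _ ?_)
      ext v
      simp only [mem_filter, mem_univ, true_and, and_iff_right_iff_imp]
      rintro rfl
      exact hy
    rw [hsum, sum_div, card_eq_sum_ones S, Nat.cast_sum, ← sum_add_distrib]
    refine (Nat.cast_le.2 ((card_le_card hsub).trans card_biUnion_le)).trans ?_
    rw [Nat.cast_sum]
    refine sum_le_sum fun y _ => (Nat.cast_le.2 card_image_le).trans ?_
    rw [card_range, Nat.cast_add, add_comm, Nat.cast_one]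
    gcongr
    exact Nat.cast_div_le

end Refinement

section UpperBound

variable [Fintype V] {G : SimpleGraph V} {q d r : ℕ} [NeZero q] {F : V → Fin d → ℕ → Fin q}

open scoped Classical in
theorem card_near_truncateAll_le
    (hF : ∀ u v, G.Adj u v →
      ∃ i j, i ≠ j ∧ ShiftRelated (F u i) (F v i) ∧ ShiftRelated (F u j) (F v j))
    {X : ℝ} (hX0 : 0 ≤ X) (hX : ∀ i j, i ≠ j → ∀ a b : Fin r → Fin q,
      (#{v | (∀ k : Fin r, F v i k = a k) ∧ ∀ k : Fin r, F v j k = b k} : ℝ) ≤ X)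
    (y : Fin d → ℕ → Fin q) :
    (#{v | ∃ u w, truncateAll (fun _ => r) (F u) = y ∧ G.Adj u w ∧
      truncateAll (fun _ => r) (F w) = truncateAll (fun _ => r) (F v)} : ℝ) ≤
      (d ^ 2 * (3 * q) ^ 2 : ℕ) * X := by
  let Z : Transition d q → Finset V := fun t =>
    {v | (∀ k : Fin r, F v t.1.1 k = shiftBy r (y t.1.1) t.2.1 k) ∧
      ∀ k : Fin r, F v t.1.2 k = shiftBy r (y t.1.2) t.2.2 k}
  have hZ : ∀ t ∈ transitions d q, (#(Z t) : ℝ) ≤ X := fun t ht =>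
    hX _ _ (by simpa [transitions] using ht) (fun k => shiftBy r (y t.1.1) t.2.1 k)
      fun k => shiftBy r (y t.1.2) t.2.2 k
  refine (Nat.cast_le.2 (card_le_card (t := (transitions d q).biUnion Z) fun v hv => ?_)).trans ?_
  · simp only [mem_filter, mem_univ, true_and, mem_biUnion, Z] at hv ⊢
    obtain ⟨u, w, rfl, huw, hwv⟩ := hv
    obtain ⟨t, ht, h1, h2⟩ := exists_transition (hF u w huw) fun _ => r
    rw [hwv] at h1 h2
    refine ⟨t, ht, fun k => ?_, fun k => ?_⟩
    · rw [← h1]; simp [truncateAll, truncate]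
    · rw [← h2]; simp [truncateAll, truncate]
  · refine (Nat.cast_le.2 card_biUnion_le).trans ?_
    rw [Nat.cast_sum]
    refine (sum_le_sum hZ).trans ?_
    rw [sum_const, nsmul_eq_mul]
    exact mul_le_mul_of_nonneg_right (Nat.cast_le.2 card_transitions_le) hX0

open scoped Classical in
theorem tww_le_of_words [DecidableEq V] (hG : IsReg G d)
    (hF : ∀ u v, G.Adj u v →
      ∃ i j, i ≠ j ∧ ShiftRelated (F u i) (F v i) ∧ ShiftRelated (F u j) (F v j))
    {X : ℝ} (hX0 : 0 ≤ X) (hX : ∀ i j, i ≠ j → ∀ a b : Fin r → Fin q,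
      (#{v | (∀ k : Fin r, F v i k = a k) ∧ ∀ k : Fin r, F v j k = b k} : ℝ) ≤ X)
    {K w : ℕ} (hK : 0 < K) (hKw : d * K ≤ w)
    (hqw : q * (d ^ 2 * (3 * q) ^ 2 * (q ^ r) ^ (d - 2)) ≤ w)
    (hXw : (d ^ 2 * (3 * q) ^ 2 : ℕ) * ((q ^ r) ^ (d - 2) + X / K) ≤ w) :
    tww G ≤ w := by
  let h : V → Fin d → ℕ → Fin q := fun v => truncateAll (fun _ => r) (F v)
  obtain ⟨ρ, hρ, hρ'⟩ := exists_subdivision h hK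
  refine tww_le_of_contractible (Contractible.of_kernel_refines (h := fun v => (h v, ρ v))
    (fun u v huv => by rw [show u = v from huv]) (fun c => ?_)
    (Contractible.of_kernel_refines (h := h) (fun u v huv => (Prod.ext_iff.1 huv).1) (fun y => ?_)
      (Contractible.of_kernel_truncateAll hF hqw (fun _ => r) fun _ => le_rfl)))
  · refine le_trans (card_le_card (t := ({v | (h v, ρ v) = c} : Finset V).biUnion fun u =>
      {v | G.Adj u v}) fun x hx => ?_) ?_
    · simp only [mem_image, mem_filter, mem_univ, true_and, mem_biUnion] at hx ⊢
      obtain ⟨v, hv, rfl⟩ := hx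
      exact hv
    · refine card_biUnion_le.trans (le_trans ?_ hKw)
      refine (sum_le_sum (g := fun _ => d) fun u _ => le_of_eq ?_).trans ?_
      · rw [← hG u, deg, Nat.card_eq_fintype_card, Fintype.card_subtype]
        rfl
      · rw [sum_const, smul_eq_mul, mul_comm]
        exact Nat.mul_le_mul_left d (by convert hρ c)
  · let S : Finset (Fin d → ℕ → Fin q) := image h {v | ∃ u, h u = y ∧ G.Adj u v}
    have hS : #S ≤ d ^ 2 * (3 * q) ^ 2 * (q ^ r) ^ (d - 2) := by
      convert card_image_truncateAll_le hF (l := fun _ => r) (fun _ => le_rfl) y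
    have hS' : (#{v | h v ∈ S} : ℝ) ≤ (d ^ 2 * (3 * q) ^ 2 : ℕ) * X := by
      refine (Nat.cast_le.2 (card_le_card fun v hv => ?_)).trans
        (card_near_truncateAll_le hF hX0 hX y)
      simp only [S, mem_filter, mem_univ, true_and, mem_image] at hv ⊢
      obtain ⟨w, ⟨u, hu, huw⟩, hwv⟩ := hv
      exact ⟨u, w, hu, huw, hwv⟩
    rw [← Nat.cast_le (α := ℝ)]
    refine le_trans ?_ hXw
    have hρS : (#(image (fun v => (h v, ρ v)) {v | h v ∈ S}) : ℝ) ≤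
        #S + (#{v | h v ∈ S} : ℝ) / K := by convert hρ' S
    refine (Nat.cast_le.2 (card_le_card fun x hx => ?_)).trans (hρS.trans ?_)
    · simp only [S, mem_image, mem_filter, mem_univ, true_and] at hx ⊢
      obtain ⟨v, hv, rfl⟩ := hx
      exact ⟨v, ⟨v, hv, rfl⟩, rfl⟩
    · rw [mul_add, ← mul_div_assoc]
      gcongr
      exact_mod_cast hS

end UpperBound

section Parameters

variable {n d : ℕ} {G : SimpleGraph (Fin n)}

theorem two_mul_le_two_pow (r : ℕ) : 2 * r ≤ 2 ^ r := by
  rcases r with _ | r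
  · simp
  · rw [pow_succ']
    exact Nat.mul_le_mul_left 2 Nat.lt_two_pow_self

theorem tww_le_of_scale (hd : 2 < d) (hG : IsReg G d) {M E : ℝ} (hM : 1 ≤ M)
    (hn : (n : ℝ) = (M ^ (d - 2)) ^ 2 * M ^ 2) {q r : ℕ} (hq : 0 < q) (hr : (q : ℝ) ^ r ≤ M)
    (hr' : M ≤ (q : ℝ) ^ (r + 1)) (hE : 1 ≤ E)
    (hME : 4 * r * (d + 1 : ℝ) ^ r * M ≤ E * M ^ (d - 2)) :
    (tww G : ℝ) ≤ 54 * d ^ 3 * q ^ 4 * E * M ^ (d - 2) := by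
  have : NeZero q := ⟨hq.ne'⟩
  obtain ⟨F, hF, hX⟩ := exists_colored_words hd hG hq r
  set T : ℝ := M ^ (d - 2) with hTdef
  have hT : 1 ≤ T := one_le_pow₀ hM
  have hd1 : (1 : ℝ) ≤ d := by exact_mod_cast (by omega : 1 ≤ d)
  have hq1 : (1 : ℝ) ≤ q := by exact_mod_cast hq
  set x : ℝ := 27 * d ^ 3 * q ^ 4 * E * T with hx
  have hqB : ((q : ℝ) ^ r) ^ (d - 2) ≤ T := pow_le_pow_left₀ (by positivity) hr _
  set X : ℝ := (Fintype.card (Fin n) : ℝ) / q ^ (2 * r) +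
    √(d ^ 2 * (Fintype.card (Fin n) * (2 * ((2 * r) ^ 2 * (d + 1) ^ (2 * r))))) with hXdef
  have hX0 : 0 ≤ X := by positivity
  have hXT : X ≤ T ^ 2 * q ^ 2 + d * E * T ^ 2 := by
    rw [hXdef, Fintype.card_fin, hn]
    refine add_le_add ?_ ?_
    · rw [div_le_iff₀ (by positivity)]
      have : M ^ 2 ≤ ((q : ℝ) ^ (r + 1)) ^ 2 := pow_le_pow_left₀ (by linarith) hr' 2
      calc T ^ 2 * M ^ 2 ≤ T ^ 2 * ((q : ℝ) ^ (r + 1)) ^ 2 := by gcongr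
        _ = _ := by ring
    · rw [Real.sqrt_le_left (by positivity)]
      calc _ = (d * T) ^ 2 * ((4 * r * (d + 1 : ℝ) ^ r * M) ^ 2 / 2) := by ring
        _ ≤ (d * T) ^ 2 * (E * T) ^ 2 := by
          gcongr
          refine (half_le_self (by positivity)).trans ?_
          gcongr
        _ = _ := by ring
  have hx1 : 1 ≤ x := by
    have h1 : (1 : ℝ) ≤ d ^ 3 := one_le_pow₀ hd1
    have h2 : (1 : ℝ) ≤ q ^ 4 := one_le_pow₀ hq1
    calc (1 : ℝ) ≤ 27 * 1 * 1 * 1 * 1 := by norm_num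
      _ ≤ x := by rw [hx]; gcongr
  have hxw : x ≤ ⌈x⌉₊ := Nat.le_ceil x
  have key : tww G ≤ ⌈x⌉₊ := by
    refine tww_le_of_words hG hF hX0 hX (K := ⌈T⌉₊) (Nat.ceil_pos.2 (by linarith)) ?_ ?_ ?_
    · rw [← Nat.cast_le (α := ℝ)]
      refine le_trans ?_ hxw
      have hK : (⌈T⌉₊ : ℝ) ≤ 2 * T := by linarith [Nat.ceil_lt_add_one (by linarith : 0 ≤ T)]
      push_cast
      calc (d : ℝ) * ⌈T⌉₊ ≤ d * (2 * T) := by gcongr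
        _ = 2 * d ^ 1 * 1 * 1 * T := by ring
        _ ≤ x := by
          rw [hx]
          gcongr
          · norm_num
          · norm_num
          · exact one_le_pow₀ hq1
    · rw [← Nat.cast_le (α := ℝ)]
      refine le_trans ?_ hxw
      push_cast
      calc (q : ℝ) * (d ^ 2 * (3 * q) ^ 2 * (q ^ r) ^ (d - 2)) ≤ q * (d ^ 2 * (3 * q) ^ 2 * T) := by
            gcongr
        _ = 9 * d ^ 2 * q ^ 3 * 1 * T := by ring
        _ ≤ x := by
          rw [hx]
          gcongr <;> norm_num
    · refine le_trans ?_ hxw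
      push_cast
      have hXK : X / ⌈T⌉₊ ≤ T * q ^ 2 + d * E * T := by
        calc X / ⌈T⌉₊ ≤ X / T := by gcongr; exact Nat.le_ceil T
          _ ≤ (T ^ 2 * q ^ 2 + d * E * T ^ 2) / T := by gcongr
          _ = _ := by field_simp
      calc (d ^ 2 * (3 * q) ^ 2 : ℝ) * ((q ^ r) ^ (d - 2) + X / ⌈T⌉₊)
          ≤ d ^ 2 * (3 * q) ^ 2 * (T + (T * q ^ 2 + d * E * T)) := by gcongr
        _ = 9 * d ^ 2 * q ^ 2 * 1 * T + 9 * d ^ 2 * q ^ 4 * 1 * T + 9 * d ^ 3 * q ^ 2 * E * T := by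
          ring
        _ ≤ 9 * d ^ 3 * q ^ 4 * E * T + 9 * d ^ 3 * q ^ 4 * E * T + 9 * d ^ 3 * q ^ 4 * E * T := by
          gcongr <;> norm_num
        _ = x := by rw [hx]; ring
  calc (tww G : ℝ) ≤ ⌈x⌉₊ := by exact_mod_cast key
    _ ≤ x + 1 := (Nat.ceil_lt_add_one (by linarith)).le
    _ ≤ 2 * x := by linarith
    _ = _ := by rw [hx]; ring

theorem tww_le_of_four_le (hd : 4 ≤ d) (hG : IsReg G d) {M : ℝ} (hM : 1 ≤ M)
    (hn : (n : ℝ) = (M ^ (d - 2)) ^ 2 * M ^ 2) : (tww G : ℝ) ≤ d ^ 15 * M ^ (d - 2) := by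
  obtain ⟨r, hr, hr'⟩ := exists_nat_pow_near hM
    (show (1 : ℝ) < (2 * d + 2 : ℕ) by exact_mod_cast (by omega : 1 < 2 * d + 2))
  have hr2 : (2 * r : ℝ) ≤ 2 ^ r := by exact_mod_cast two_mul_le_two_pow r
  have hd4 : (4 : ℝ) ≤ d := by exact_mod_cast hd
  have hE : 4 * r * (d + 1 : ℝ) ^ r * M ≤ 2 * M ^ (d - 2) := by
    calc 4 * r * (d + 1 : ℝ) ^ r * M = 2 * ((2 * r) * (d + 1 : ℝ) ^ r * M) := by ring
      _ ≤ 2 * (2 ^ r * (d + 1 : ℝ) ^ r * M) := by gcongr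
      _ = 2 * (((2 * d + 2 : ℕ) : ℝ) ^ r * M) := by rw [← mul_pow]; push_cast; ring
      _ ≤ 2 * (M * M) := by gcongr
      _ = 2 * M ^ 2 := by ring
      _ ≤ 2 * M ^ (d - 2) := by gcongr 2 * ?_; exact pow_le_pow_right₀ hM (by omega)
  refine (tww_le_of_scale (by omega) hG hM hn (by omega) hr hr'.le one_le_two hE).trans ?_
  gcongr
  push_cast
  calc 54 * (d : ℝ) ^ 3 * (2 * d + 2) ^ 4 * (2 : ℝ) ≤ 54 * (d : ℝ) ^ 3 * (4 * d) ^ 4 * (2 : ℝ) := by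
        gcongr; linarith
    _ = 27648 * (d : ℝ) ^ 7 := by ring
    _ ≤ 4 ^ 8 * (d : ℝ) ^ 7 := by gcongr; norm_num
    _ ≤ (d : ℝ) ^ 8 * d ^ 7 := by gcongr
    _ = (d : ℝ) ^ 15 := by ring

theorem tww_le_of_cubic (hG : IsReg G 3) {M s : ℝ} (hM : 1 ≤ M) (hn : (n : ℝ) = M ^ 2 * M ^ 2)
    (hs : 0 < s) (hMs : Real.log M ≤ s ^ 2 / 4) :
    (tww G : ℝ) ≤ 46656 * Real.exp (5 * s) * M := by
  have hexp : 1 < Real.exp s := Real.one_lt_exp_iff.2 hs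
  obtain ⟨r, hr, hr'⟩ := exists_nat_pow_near hM (hexp.trans_le (Nat.le_ceil _))
  have hq : (⌈Real.exp s⌉₊ : ℝ) ≤ 2 * Real.exp s := by
    linarith [Nat.ceil_lt_add_one (Real.exp_pos s).le]
  have hrs : 4 * r ≤ s := by
    have h1 : Real.exp s ^ r ≤ M :=
      (pow_le_pow_left₀ (Real.exp_pos s).le (Nat.le_ceil _) r).trans hr
    have h2 := Real.log_le_log (by positivity) h1
    rw [Real.log_pow, Real.log_exp] at h2
    nlinarith
  have h8 : (8 : ℝ) ^ r ≤ Real.exp s := by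
    have he : (8 : ℝ) ≤ Real.exp 4 := by
      have := Real.add_one_le_exp 1
      calc (8 : ℝ) ≤ 2 ^ 4 := by norm_num
        _ ≤ Real.exp 1 ^ 4 := by gcongr; linarith
        _ = Real.exp 4 := by rw [← Real.exp_nat_mul]; norm_num
    calc (8 : ℝ) ^ r ≤ Real.exp 4 ^ r := by gcongr
      _ = Real.exp (4 * r) := by rw [← Real.exp_nat_mul]; ring_nf
      _ ≤ _ := Real.exp_le_exp.2 hrs
  have hr2 : (2 * r : ℝ) ≤ 2 ^ r := by exact_mod_cast two_mul_le_two_pow r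
  have hE : 4 * r * ((3 : ℕ) + 1 : ℝ) ^ r * M ≤ 2 * Real.exp s * M ^ (3 - 2) := by
    calc 4 * r * ((3 : ℕ) + 1 : ℝ) ^ r * M = 2 * ((2 * r) * 4 ^ r) * M := by
          rw [show ((3 : ℕ) + 1 : ℝ) = 4 by norm_num]
          ring
      _ ≤ 2 * (2 ^ r * 4 ^ r) * M := by gcongr
      _ = 2 * 8 ^ r * M := by rw [← mul_pow]; norm_num
      _ ≤ 2 * Real.exp s * M ^ (3 - 2) := by rw [pow_one]; gcongr
  refine (tww_le_of_scale (by norm_num) hG hM (by simpa using hn) (Nat.ceil_pos.2 (by positivity))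
    hr hr'.le (by linarith) hE).trans ?_
  rw [pow_one]
  refine mul_le_mul_of_nonneg_right ?_ (by linarith)
  calc 54 * ((3 : ℕ) : ℝ) ^ 3 * (⌈Real.exp s⌉₊ : ℝ) ^ 4 * (2 * Real.exp s)
      ≤ 54 * ((3 : ℕ) : ℝ) ^ 3 * (2 * Real.exp s) ^ 4 * (2 * Real.exp s) := by gcongr
    _ = 46656 * Real.exp s ^ 5 := by norm_num; ring
    _ = _ := by rw [← Real.exp_nat_mul]; norm_num

theorem one_fourth_le_log_log {x : ℝ} (hx : 4 ≤ x) : 1 / 4 ≤ Real.log (Real.log x) := by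
  have h2 := Real.log_two_gt_d9
  have h4 : 4 / 3 ≤ Real.log 4 := by
    rw [show (4 : ℝ) = 2 ^ 2 by norm_num, Real.log_pow]
    norm_num at h2 ⊢
    linarith
  have hlog : 4 / 3 ≤ Real.log x := h4.trans (Real.log_le_log (by norm_num) hx)
  refine le_trans ?_ (Real.log_le_log (by norm_num) hlog)
  have := Real.one_sub_inv_le_log_of_pos (show (0 : ℝ) < 4 / 3 by norm_num)
  norm_num at this ⊢
  exact this

theorem tww_of_isEmpty [Fintype V] [DecidableEq V] [IsEmpty V] (G : SimpleGraph V) : tww G = 0 :=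
  Nat.le_zero.1 <| tww_le_of_contractible fun P _ => .of_card_le_one <| card_le_one.2 fun _ hA =>
    isEmptyElim (P.nonempty_of_mem_parts hA).choose

end Parameters

theorem statement_15 :
    ∃ C : ℝ, 0 < C ∧ ∀ (n d : ℕ) (G : SimpleGraph (Fin n)),
      2 < d → IsReg G d →
      (tww G : ℝ) ≤ (n : ℝ) ^ (((d : ℝ) - 2) / (2 * (d : ℝ) - 2)) *
        Real.exp (C * ((d : ℝ)⁻¹ * Real.sqrt (Real.log n) * Real.log (Real.log n) +
          Real.log d)) := by
  refine ⟨60, by norm_num, fun n d G hd hG => ?_⟩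
  rcases Nat.eq_zero_or_pos n with rfl | hn0
  · rw [tww_of_isEmpty, Nat.cast_zero]
    positivity
  have hdn : d < n := by
    classical
    have := G.degree_lt_card_verts ⟨0, hn0⟩
    rwa [Fintype.card_fin, ← SimpleGraph.card_neighborSet_eq_degree, ← Nat.card_eq_fintype_card,
      ← deg, hG] at this
  have hd3 : (3 : ℝ) ≤ d := by exact_mod_cast hd
  have hn4 : (4 : ℝ) ≤ n := by exact_mod_cast (by omega : 4 ≤ n)
  have hll := one_fourth_le_log_log hn4
  have hlogn : 0 < Real.log n := Real.log_pos (by linarith)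
  set M : ℝ := (n : ℝ) ^ (1 / (2 * (d : ℝ) - 2)) with hMdef
  have hd2 : 0 < 2 * (d : ℝ) - 2 := by linarith
  have hM : 1 ≤ M := Real.one_le_rpow (by linarith) (by positivity)
  have hpow : ∀ k : ℕ, M ^ k = (n : ℝ) ^ (k / (2 * (d : ℝ) - 2)) := fun k => by
    rw [hMdef, ← Real.rpow_mul_natCast (by positivity)]
    congr 1
    ring
  have hT : (n : ℝ) ^ (((d : ℝ) - 2) / (2 * (d : ℝ) - 2)) = M ^ (d - 2) := by
    rw [hpow, Nat.cast_sub hd.le, Nat.cast_two]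
  have hn : (n : ℝ) = (M ^ (d - 2)) ^ 2 * M ^ 2 := by
    rw [← pow_mul, ← pow_add, hpow, show (((d - 2) * 2 + 2 : ℕ) : ℝ) = 2 * (d : ℝ) - 2 by
      push_cast [Nat.cast_sub hd.le]; ring, div_self hd2.ne', Real.rpow_one]
  have hM0 : 0 < M := by linarith
  rw [hT, mul_comm]
  rcases (by omega : 4 ≤ d ∨ d = 3) with h4 | rfl
  · refine (tww_le_of_four_le h4 hG hM hn).trans ?_
    gcongr
    calc (d : ℝ) ^ 15 ≤ d ^ 60 := pow_le_pow_right₀ (by linarith) (by norm_num)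
      _ = Real.exp (60 * Real.log d) := by
        rw [← Real.exp_log (show (0 : ℝ) < d by linarith), ← Real.exp_nat_mul, Real.log_exp]
        norm_num
      _ ≤ _ := by
        gcongr
        have : 0 ≤ (d : ℝ)⁻¹ * √(Real.log n) * Real.log (Real.log n) := by positivity
        linarith
  · have hs : 0 < √(Real.log n) := Real.sqrt_pos.2 hlogn
    refine (tww_le_of_cubic hG hM (by simpa using hn) hs ?_).trans ?_
    · rw [Real.sq_sqrt hlogn.le, hMdef, Real.log_rpow (by linarith)]
      norm_num
      linarith
    · rw [pow_one]
      gcongr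
      have h3 : 1 ≤ Real.log 3 := by
        rw [Real.le_log_iff_exp_le (by norm_num)]
        exact Real.exp_one_lt_three.le
      have hconst : (46656 : ℝ) ≤ Real.exp 60 := by
        have := Real.add_one_le_exp 1
        calc (46656 : ℝ) ≤ 2 ^ 60 := by norm_num
          _ ≤ Real.exp 1 ^ 60 := by gcongr; linarith
          _ = Real.exp 60 := by rw [← Real.exp_nat_mul]; norm_num
      calc 46656 * Real.exp (5 * √(Real.log n)) ≤ Real.exp 60 * Real.exp (5 * √(Real.log n)) := by
            gcongr
        _ = Real.exp (60 + 5 * √(Real.log n)) := (Real.exp_add _ _).symm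
        _ ≤ _ := by
          gcongr
          push_cast
          nlinarith

end TwwPaper
end
end

section
/- Let G be a graph with mad(G) = d and ℓ = log v(G). If 2 + ℓ^{−1/6} ≤ d ≤ ℓ/(30·log ℓ) and log Δ(G) ≤ ℓ^{1/6}, then stww(G) ≤ Δ(G) · v(G)^{(d−2)/(2d−2)} · exp(O(d^{−1}·ℓ^{1/2}·log ℓ + log d)). -/
noncomputable section

namespace TwwPaper

open Finset

variable {V : Type*}

section Contraction

variable [Fintype V]

/-- The vertices with a neighbour in `C`. -/
def nbhd (G : SimpleGraph V) (C : Finset V) : Finset V := by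
  classical exact univ.filter fun v => ∃ u ∈ C, G.Adj u v

lemma mem_nbhd {G : SimpleGraph V} {C : Finset V} {v : V} :
    v ∈ nbhd G C ↔ ∃ u ∈ C, G.Adj u v := by
  simp [nbhd]

variable [DecidableEq V]

/-- The partition obtained from `P` by merging the parts `A` and `B`. -/
lemma exists_merge (P : Finpartition (univ : Finset V)) {A B : Finset V} (hA : A ∈ P.parts)
    (hB : B ∈ P.parts) :
    ∃ Q : Finpartition (univ : Finset V),
      Q.parts = insert (A ∪ B) ((P.parts.erase A).erase B) := by
  refine ⟨Finpartition.ofExistsUnique _ (fun p _ => subset_univ p) ?_ ?_, rfl⟩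
  · intro v _
    by_cases hv : v ∈ A ∪ B
    · refine ⟨A ∪ B, ⟨mem_insert_self _ _, hv⟩, ?_⟩
      rintro T ⟨hT, hvT⟩
      rcases mem_insert.1 hT with rfl | hT
      · rfl
      · simp only [mem_erase] at hT
        rcases mem_union.1 hv with h | h
        · exact absurd (P.eq_of_mem_parts hT.2.2 hA hvT h) hT.2.1
        · exact absurd (P.eq_of_mem_parts hT.2.2 hB hvT h) hT.1
    · obtain ⟨T, hT, hvT⟩ := P.exists_mem (mem_univ v)
      refine ⟨T, ⟨mem_insert_of_mem ?_, hvT⟩, ?_⟩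
      · simp only [mem_erase]
        refine ⟨?_, ?_, hT⟩ <;> rintro rfl <;> exact hv (by simp [hvT])
      · rintro U ⟨hU, hvU⟩
        rcases mem_insert.1 hU with rfl | hU
        · exact absurd hvU hv
        · simp only [mem_erase] at hU
          exact P.eq_of_mem_parts hU.2.2 hT hvU hvT
  · intro h
    rcases mem_insert.1 h with h | h
    · obtain ⟨x, hx⟩ := P.nonempty_of_mem_parts hA
      have : x ∈ (∅ : Finset V) := h ▸ mem_union_left _ hx
      simp at this
    · simp only [mem_erase] at h
      exact P.empty_notMem_parts h.2.2

lemma exists_mergeStep_le {P Q : Finpartition (univ : Finset V)} (h : P ≤ Q) (hne : P ≠ Q) :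
    ∃ P', IsMergeStep P P' ∧ P ≤ P' ∧ P' ≤ Q ∧ P'.parts.card < P.parts.card := by
  obtain ⟨A, hA, B, hB, hAB, C, hC, hAC, hBC⟩ : ∃ A ∈ P.parts, ∃ B ∈ P.parts, A ≠ B ∧
      ∃ C ∈ Q.parts, A ⊆ C ∧ B ⊆ C := by
    by_contra! hcon
    apply hne
    refine le_antisymm h fun C hC => ?_
    obtain ⟨x, hx⟩ := Q.nonempty_of_mem_parts hC
    obtain ⟨A, hA, hxA⟩ := P.exists_mem (mem_univ x)
    have hsub : ∀ B ∈ P.parts, ∀ y ∈ B, y ∈ C → B ⊆ C := by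
      intro B hB y hy hyC
      obtain ⟨D, hD, hBD⟩ := h hB
      rwa [Q.eq_of_mem_parts hC hD hyC (hBD hy)]
    refine ⟨A, hA, fun y hy => ?_⟩
    obtain ⟨B, hB, hyB⟩ := P.exists_mem (mem_univ y)
    by_cases hAB : A = B
    · rwa [hAB]
    · exact absurd (hsub B hB y hyB hy) (hcon A hA B hB hAB C hC (hsub A hA x hxA hx))
  obtain ⟨P', hP'⟩ := exists_merge P hA hB
  refine ⟨P', ⟨A, hA, B, hB, hAB, hP'⟩, ?_, ?_, ?_⟩
  · intro D hD
    by_cases h1 : D = A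
    · exact ⟨A ∪ B, by simp [hP'], by simp [h1]⟩
    by_cases h2 : D = B
    · exact ⟨A ∪ B, by simp [hP'], by simp [h2]⟩
    exact ⟨D, by simp [hP', h1, h2, hD], le_rfl⟩
  · intro D hD
    rw [hP', mem_insert] at hD
    rcases hD with rfl | hD
    · exact ⟨C, hC, union_subset hAC hBC⟩
    · simp only [mem_erase] at hD
      exact h hD.2.2
  · rw [hP']
    have h1 := card_erase_add_one hA
    have h2 := card_erase_add_one (mem_erase.2 ⟨hAB.symm, hB⟩)
    have h3 := card_insert_le (A ∪ B) ((P.parts.erase A).erase B)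
    omega

/-- If `P ≤ P' ≤ Q`, the degrees in `G / P'` are bounded by the number of parts of `P`
seen from a part of `Q`. -/
lemma quotDeg_le_of_between {G : SimpleGraph V} {P P' Q : Finpartition (univ : Finset V)} {w : ℕ}
    (hP : P ≤ P') (hQ : P' ≤ Q) (H : ∀ C ∈ Q.parts, ((nbhd G C).image P.part).card ≤ w)
    {A : Finset V} (hA : A ∈ P'.parts) : quotDeg G P' A ≤ w := by
  classical
  obtain ⟨C, hC, hAC⟩ := hQ hA
  refine le_trans ?_ (H C hC)
  have hex : ∀ B : {B : Finset V // B ∈ P'.parts ∧ B ≠ A ∧ ∃ u ∈ A, ∃ v ∈ B, G.Adj u v},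
      ∃ v ∈ B.1, ∃ u ∈ A, G.Adj u v := by
    rintro ⟨B, -, -, u, hu, v, hv, huv⟩
    exact ⟨v, hv, u, hu, huv⟩
  choose g hg hg' using hex
  rw [quotDeg, ← Fintype.card_coe, ← Nat.card_eq_fintype_card]
  refine Nat.card_le_card_of_injective (fun B => ⟨P.part (g B), ?_⟩) ?_
  · obtain ⟨u, hu, huv⟩ := hg' B
    exact mem_image_of_mem _ (mem_nbhd.2 ⟨u, hAC hu, huv⟩)
  · intro B B' hBB
    simp only [Subtype.mk.injEq] at hBB
    obtain ⟨D, hD, hsub⟩ := hP (P.part_mem.2 (mem_univ (g B)))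
    have h1 : g B ∈ D := hsub (P.mem_part_self.2 (mem_univ _))
    have h2 : g B' ∈ D := hsub (hBB ▸ P.mem_part_self.2 (mem_univ _))
    apply Subtype.ext
    rw [P'.eq_of_mem_parts B.2.1 hD (hg B) h1, P'.eq_of_mem_parts B'.2.1 hD (hg B') h2]

/-- A merge step after which all quotient degrees are at most `w`. -/
def GoodStep (G : SimpleGraph V) (w : ℕ) (P Q : Finpartition (univ : Finset V)) : Prop :=
  IsMergeStep P Q ∧ ∀ A ∈ Q.parts, quotDeg G Q A ≤ w

lemma reflTransGen_goodStep {G : SimpleGraph V} {w : ℕ} {P Q : Finpartition (univ : Finset V)}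
    (h : P ≤ Q) (H : ∀ C ∈ Q.parts, ((nbhd G C).image P.part).card ≤ w) :
    Relation.ReflTransGen (GoodStep G w) P Q := by
  suffices ∀ m : ℕ, ∀ P', P'.parts.card = m → P ≤ P' → P' ≤ Q →
      Relation.ReflTransGen (GoodStep G w) P' Q from this _ P rfl le_rfl h
  intro m
  induction m using Nat.strong_induction_on with
  | _ m ih =>
    intro P' hm hP hQ
    by_cases hne : P' = Q
    · rw [hne]
    obtain ⟨P'', hstep, hle, hle', hcard⟩ := exists_mergeStep_le hQ hne
    exact Relation.ReflTransGen.head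
      ⟨hstep, fun A hA => quotDeg_le_of_between (hP.trans hle) hle' H hA⟩
      (ih _ (hm ▸ hcard) P'' rfl (hP.trans hle) hle')

lemma exists_seq_of_reflTransGen {α : Type*} {r : α → α → Prop} {x y : α}
    (h : Relation.ReflTransGen r x y) :
    ∃ (n : ℕ) (p : ℕ → α), p 0 = x ∧ p n = y ∧ ∀ i < n, r (p i) (p (i + 1)) := by
  induction h using Relation.ReflTransGen.head_induction_on with
  | refl => exact ⟨0, fun _ => y, rfl, rfl, by simp⟩
  | @head a c hac _ ih =>
    obtain ⟨n, p, h0, hn, hs⟩ := ih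
    refine ⟨n + 1, fun i => Nat.casesOn i a p, rfl, hn, ?_⟩
    rintro (_ | i) hi
    · simpa [h0] using hac
    · exact hs i (by omega)

lemma seqOK_of_reflTransGen {G : SimpleGraph V} {w : ℕ} {Q : Finpartition (univ : Finset V)}
    (hw : ∀ A ∈ (⊥ : Finpartition (univ : Finset V)).parts, quotDeg G ⊥ A ≤ w)
    (hQ : Q.parts.card ≤ 1) (h : Relation.ReflTransGen (GoodStep G w) ⊥ Q) :
    SeqOK G quotDeg w := by
  obtain ⟨n, p, h0, hn, hs⟩ := exists_seq_of_reflTransGen h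
  refine ⟨n, fun i => p i, ?_, ?_, ?_, ?_⟩
  · intro A hA
    simp only [Fin.val_zero, h0, Finpartition.mem_bot_iff] at hA
    obtain ⟨a, -, rfl⟩ := hA
    simp
  · simpa [hn] using hQ
  · intro i
    exact (hs i i.2).1
  · rintro ⟨i, hi⟩ A hA
    rcases i with _ | i
    · simp only [h0] at hA ⊢
      exact hw A hA
    · exact (hs i (by omega)).2 A hA

/-- The partition of `V` into the fibres of `φ`. -/
def fibrePart {X : Type*} (φ : V → X) : Finpartition (univ : Finset V) := by
  classical exact Finpartition.ofSetoid (Setoid.ker φ)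

lemma mem_part_fibrePart {X : Type*} {φ : V → X} {u v : V} :
    v ∈ (fibrePart φ).part u ↔ φ u = φ v := by
  classical
  rw [fibrePart, Finpartition.mem_part_ofSetoid_iff_rel]
  rfl

lemma mem_fibrePart_parts {X : Type*} {φ : V → X} {A : Finset V}
    (hA : A ∈ (fibrePart φ).parts) : ∃ u, ∀ v, v ∈ A ↔ φ u = φ v := by
  obtain ⟨u, hu⟩ := (fibrePart φ).nonempty_of_mem_parts hA
  refine ⟨u, fun v => ?_⟩
  rw [← (fibrePart φ).part_eq_of_mem hA hu]
  exact mem_part_fibrePart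

lemma part_fibrePart_congr {X : Type*} {φ : V → X} {u v : V} (h : φ u = φ v) :
    (fibrePart φ).part u = (fibrePart φ).part v := by
  ext x
  simp only [mem_part_fibrePart, h]

lemma fibrePart_mono {X Y : Type*} {φ : V → X} {ψ : V → Y}
    (h : ∀ u v, φ u = φ v → ψ u = ψ v) : fibrePart φ ≤ fibrePart ψ := by
  intro A hA
  obtain ⟨u, hu⟩ := mem_fibrePart_parts hA
  refine ⟨(fibrePart ψ).part u, Finpartition.part_mem _ |>.2 (mem_univ u), fun v hv => ?_⟩
  exact mem_part_fibrePart.2 (h _ _ ((hu v).1 hv))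

lemma card_image_part_fibrePart_le {X : Type*} [DecidableEq X] (φ : V → X) (N : Finset V) :
    (N.image (fibrePart φ).part).card ≤ (N.image φ).card := by
  classical
  rcases isEmpty_or_nonempty V with hV | hV
  · simp [eq_empty_of_isEmpty N]
  have : N.image (fibrePart φ).part ⊆
      (N.image φ).image fun x => (fibrePart φ).part (Function.invFun φ x) := by
    intro A hA
    obtain ⟨v, hv, rfl⟩ := mem_image.1 hA
    refine mem_image.2 ⟨φ v, mem_image_of_mem _ hv, part_fibrePart_congr ?_⟩
    exact Function.invFun_eq ⟨v, rfl⟩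
  exact (card_le_card this).trans card_image_le

/-- A chain of coarser and coarser colourings `φ 0, φ 1, …, φ k`, the last being constant,
bounds the sparse twin-width. -/
theorem stww_le_of_chain {X : Type*} [DecidableEq X] (G : SimpleGraph V) (φ : ℕ → V → X) (k w : ℕ)
    (hmono : ∀ j, ∀ u v, φ j u = φ j v → φ (j + 1) u = φ (j + 1) v)
    (hconst : ∀ u v, φ k u = φ k v)
    (h0 : ∀ u, (nbhd G (univ.filter fun v => φ 0 u = φ 0 v)).card ≤ w)
    (hstep : ∀ j, ∀ u,
      ((nbhd G (univ.filter fun v => φ (j + 1) u = φ (j + 1) v)).image (φ j)).card ≤ w) :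
    stww G ≤ w := by
  have hbot : ∀ C ∈ (fibrePart (φ 0)).parts,
      ((nbhd G C).image (⊥ : Finpartition (univ : Finset V)).part).card ≤ w := by
    intro C hC
    obtain ⟨u, hu⟩ := mem_fibrePart_parts hC
    have : C = univ.filter fun v => φ 0 u = φ 0 v := by ext v; simp [hu]
    exact card_image_le.trans (this ▸ h0 u)
  have hchain : ∀ j, Relation.ReflTransGen (GoodStep G w) ⊥ (fibrePart (φ j)) := by
    intro j
    induction j with
    | zero => exact reflTransGen_goodStep bot_le hbot
    | succ j ih =>
      refine ih.trans (reflTransGen_goodStep (fibrePart_mono (hmono j)) fun C hC => ?_)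
      obtain ⟨u, hu⟩ := mem_fibrePart_parts hC
      have : C = univ.filter fun v => φ (j + 1) u = φ (j + 1) v := by ext v; simp [hu]
      exact (card_image_part_fibrePart_le _ _).trans (this ▸ hstep j u)
  refine Nat.sInf_le (seqOK_of_reflTransGen ?_ ?_ (hchain k))
  · exact fun A hA => quotDeg_le_of_between le_rfl bot_le hbot hA
  · refine card_le_one.2 fun A hA B hB => ?_
    obtain ⟨u, hu⟩ := mem_fibrePart_parts hA
    obtain ⟨v, hv⟩ := mem_fibrePart_parts hB
    ext x
    rw [hu, hv]
    simp [hconst _ x]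

lemma stww_le_card (G : SimpleGraph V) : stww G ≤ Fintype.card V :=
  stww_le_of_chain G (fun _ _ => ()) 0 _ (fun _ _ _ _ => rfl) (fun _ _ => rfl)
    (fun _ => card_le_univ _) fun _ _ => card_image_le.trans (card_le_univ _)

end Contraction

section Decomposition

/-- A square matrix of natural numbers with all line sums equal to `k` is a sum of `k`
permutation matrices. -/
lemma exists_perms_of_line_sums {ι : Type*} [Fintype ι] [DecidableEq ι] (k : ℕ) (M : ι → ι → ℕ)
    (hr : ∀ i, ∑ j, M i j = k) (hc : ∀ j, ∑ i, M i j = k) :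
    ∃ σ : Fin k → Equiv.Perm ι, ∀ i j, (univ.filter fun c => σ c i = j).card = M i j := by
  induction k generalizing M with
  | zero =>
    refine ⟨Fin.elim0, fun i j => ?_⟩
    have := hr i
    simp only [sum_eq_zero_iff, mem_univ, true_imp_iff] at this
    simp [this j]
  | succ k ih =>
    let t (i : ι) : Finset ι := univ.filter fun j => M i j ≠ 0
    have hall (A : Finset ι) : A.card ≤ (A.biUnion t).card := by
      have h₁ : ∑ i ∈ A, ∑ j ∈ t i, M i j = A.card * (k + 1) := by
        rw [sum_congr rfl fun i _ => (sum_filter_ne_zero (s := univ) (f := M i)).trans (hr i)]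
        simp
      have h₂ : ∑ i, ∑ j ∈ A.biUnion t, M i j = (A.biUnion t).card * (k + 1) := by
        rw [sum_comm, sum_congr rfl fun j _ => hc j]
        simp
      have h₃ : ∑ i ∈ A, ∑ j ∈ t i, M i j ≤ ∑ i, ∑ j ∈ A.biUnion t, M i j :=
        (sum_le_sum fun i hi => sum_le_sum_of_subset (subset_biUnion_of_mem t hi)).trans
          (sum_le_sum_of_subset (subset_univ A))
      exact Nat.le_of_mul_le_mul_right (h₁ ▸ h₂ ▸ h₃) (Nat.succ_pos k)
    obtain ⟨g, hg, hgt⟩ := (all_card_le_biUnion_card_iff_exists_injective t).1 hall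
    have hpos : ∀ i, 0 < M i (g i) := fun i =>
      Nat.pos_of_ne_zero (by simpa [t] using hgt i)
    let τ : Equiv.Perm ι := Equiv.ofBijective g (Finite.injective_iff_bijective.1 hg)
    have hτ : ∀ i, τ i = g i := fun _ => rfl
    have hle : ∀ i j, (if τ i = j then 1 else 0) ≤ M i j := by
      intro i j
      split_ifs with h
      · rw [← h, hτ]; exact hpos i
      · exact Nat.zero_le _
    obtain ⟨σ, hσ⟩ := ih (fun i j => M i j - if τ i = j then 1 else 0)
      (fun i => by
        rw [sum_tsub_distrib _ fun j _ => hle i j, hr]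
        simp)
      (fun j => by
        rw [sum_tsub_distrib _ fun i _ => hle i j, hc]
        have : ∑ i, (if τ i = j then 1 else 0) = 1 := by
          rw [sum_congr rfl fun i _ => if_congr (Equiv.eq_symm_apply τ).symm rfl rfl]
          simp
        omega)
    refine ⟨Fin.cons τ σ, fun i j => ?_⟩
    have h := hσ i j
    have h' := hle i j
    rw [Fin.card_filter_univ_succ]
    simp only [Fin.cons_zero, Fin.cons_succ]
    split_ifs at h h' ⊢ <;> simp_all

variable [Fintype V]

lemma two_mul_edgesIn_le (G : SimpleGraph V) (X : Finset V) :
    (2 * edgesIn G X : ℝ) ≤ mad G * X.card := by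
  rcases X.eq_empty_or_nonempty with rfl | hX
  · have : edgesIn G ∅ = 0 := by
      rw [edgesIn, Nat.card_eq_zero]
      left
      refine ⟨?_⟩
      rintro ⟨e, -, he⟩
      induction e with
      | _ u v => simpa using he u (by simp)
    simp [this]
  · have h := le_ciSup (f := fun X : {X : Finset V // X.Nonempty} =>
      (2 * edgesIn G X.1 : ℝ) / X.1.card) (Set.finite_range _).bddAbove ⟨X, hX⟩
    have h0 : (0 : ℝ) < X.card := by exact_mod_cast hX.card_pos
    exact (div_le_iff₀ h0).1 h

variable [DecidableEq V]

/-- Hall's theorem assigns `b` tails to every edge so that no vertex is used more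
than `a` times. -/
lemma exists_tail_multiplicities (G : SimpleGraph V) {a b : ℕ} (hmad : mad G * b ≤ 2 * a) :
    ∃ m : G.edgeSet → V → ℕ, (∀ e v, m e v ≠ 0 → v ∈ (e : Sym2 V)) ∧
      (∀ e, ∑ v, m e v = b) ∧ (∀ v, ∑ᶠ e, m e v ≤ a) := by
  classical
  have := Fintype.ofFinite G.edgeSet
  let t (x : G.edgeSet × Fin b) : Finset (V × Fin a) :=
    (univ.filter fun v => v ∈ (x.1 : Sym2 V)) ×ˢ univ
  have hall (S : Finset (G.edgeSet × Fin b)) : S.card ≤ (S.biUnion t).card := by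
    set X : Finset V := univ.filter fun v => ∃ x ∈ S, v ∈ (x.1 : Sym2 V) with hX
    have h1 : S.biUnion t = X ×ˢ univ := by
      ext ⟨v, c⟩
      simp [t, hX]
    have h2 : S.card ≤ (S.image Prod.fst).card * b := by
      have : S ⊆ S.image Prod.fst ×ˢ univ := fun x hx => by
        simp only [mem_product, mem_univ, and_true]
        exact mem_image_of_mem _ hx
      simpa using card_le_card this
    have h3 : (S.image Prod.fst).card ≤ edgesIn G X := by
      rw [edgesIn, ← Fintype.card_coe, ← Nat.card_eq_fintype_card]
      refine Nat.card_le_card_of_injective (fun e => ⟨e.1.1, e.1.2, fun v hv => ?_⟩) ?_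
      · obtain ⟨x, hx, hxe⟩ := mem_image.1 e.2
        simp only [hX, mem_filter, mem_univ, true_and]
        exact ⟨x, hx, hxe ▸ hv⟩
      · intro e e' h
        have h' := congrArg (fun z => z.1) h
        exact Subtype.ext (Subtype.ext h')
    have h4 : (2 : ℝ) * (b * edgesIn G X) ≤ 2 * (a * X.card) := by
      have := mul_le_mul_of_nonneg_left (two_mul_edgesIn_le G X) (Nat.cast_nonneg (α := ℝ) b)
      have := mul_le_mul_of_nonneg_right hmad (Nat.cast_nonneg (α := ℝ) X.card)
      linarith
    have h5 : b * edgesIn G X ≤ a * X.card := by exact_mod_cast le_of_mul_le_mul_left h4 two_pos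
    rw [h1, card_product, card_univ, Fintype.card_fin]
    calc S.card ≤ (S.image Prod.fst).card * b := h2
      _ ≤ edgesIn G X * b := Nat.mul_le_mul_right _ h3
      _ ≤ X.card * a := by linarith
  obtain ⟨g, hg, hgt⟩ := (all_card_le_biUnion_card_iff_exists_injective t).1 hall
  refine ⟨fun e v => (univ.filter fun k : Fin b => (g (e, k)).1 = v).card, ?_, ?_, ?_⟩
  · intro e v h
    obtain ⟨k, hk⟩ := card_ne_zero.1 h
    have := hgt (e, k)
    simp only [mem_filter, mem_univ, true_and] at hk
    simpa [t, hk] using this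
  · intro e
    rw [← card_eq_sum_card_fiberwise fun _ _ => mem_coe.2 (mem_univ _)]
    simp
  · intro v
    rw [finsum_eq_sum_of_fintype]
    calc ∑ e, (univ.filter fun k : Fin b => (g (e, k)).1 = v).card
        = (univ.filter fun x : G.edgeSet × Fin b => (g x).1 = v).card := by
          rw [← card_sigma]
          refine card_bij' (fun x _ => (x.1, x.2)) (fun x _ => ⟨x.1, x.2⟩) ?_ ?_ ?_ ?_ <;> simp
      _ ≤ (univ : Finset (Fin a)).card := by
          refine card_le_card_of_injOn (fun x => (g x).2) (fun _ _ => mem_coe.2 (mem_univ _)) ?_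
          intro x hx y hy hxy
          simp only [coe_filter, mem_univ, true_and, Set.mem_ofPred_eq] at hx hy
          exact hg (Prod.ext (hx.trans hy.symm) hxy)
      _ = a := by simp

/-- A graph with `mad G ≤ 2 a / b` is covered `b`-fold by `a` functional graphs. -/
theorem exists_functional_cover (G : SimpleGraph V) {a b : ℕ} (hab : b ≤ a)
    (hmad : mad G * b ≤ 2 * a) :
    ∃ f : Fin a → V → V, (∀ i v, f i v = v ∨ G.Adj v (f i v)) ∧
      ∀ u v, G.Adj u v → b ≤ (univ.filter fun i => f i u = v ∨ f i v = u).card := by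
  classical
  have := Fintype.ofFinite G.edgeSet
  obtain ⟨m, hmem, hrow, hcol⟩ := exists_tail_multiplicities G hmad
  simp only [finsum_eq_sum_of_fintype] at hcol
  let M : G.edgeSet ⊕ V → G.edgeSet ⊕ V → ℕ := Sum.elim
    (fun e => Sum.elim (fun e' => if e = e' then a - b else 0) (m e))
    (fun v => Sum.elim (fun e => m e v) (fun v' => if v = v' then a - ∑ e, m e v else 0))
  obtain ⟨σ, hσ⟩ := exists_perms_of_line_sums a M
    (by
      rintro (e | v)
      · simp [M, hrow]; omega
      · have := hcol v
        simp [M]; omega)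
    (by
      rintro (e | v)
      · simp [M, hrow]; omega
      · have := hcol v
        simp [M]; omega)
  have hσmem : ∀ c e v, σ c (Sum.inl e) = Sum.inr v → v ∈ (e : Sym2 V) := by
    intro c e v h
    refine hmem e v ?_
    rw [show m e v = M (Sum.inl e) (Sum.inr v) from rfl, ← hσ]
    exact card_ne_zero.2 ⟨c, by simpa using h⟩
  let f : Fin a → V → V := fun c v =>
    if h : ∃ e, σ c (Sum.inl e) = Sum.inr v then Sym2.Mem.other (hσmem c _ v h.choose_spec) else v
  have hf : ∀ c e v w, σ c (Sum.inl e) = Sum.inr v → (e : Sym2 V) = s(v, w) → f c v = w := by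
    intro c e v w h hw
    have hex : ∃ e, σ c (Sum.inl e) = Sum.inr v := ⟨e, h⟩
    have he : hex.choose = e := by
      have := (σ c).injective (hex.choose_spec.trans h.symm)
      simpa using this
    have h1 := Sym2.other_spec (hσmem c _ v hex.choose_spec)
    simp only [f, dif_pos hex]
    rw [← Sym2.congr_right (a := v), h1, he, hw]
  refine ⟨f, fun c v => ?_, fun u v huv => ?_⟩
  · by_cases hex : ∃ e, σ c (Sum.inl e) = Sum.inr v
    · right
      have h1 := Sym2.other_spec (hσmem c _ v hex.choose_spec)
      have h2 := hex.choose.2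
      rw [← h1] at h2
      simp only [f, dif_pos hex]
      exact h2
    · left
      simp only [f, dif_neg hex]
  · let e : G.edgeSet := ⟨s(u, v), huv⟩
    have hsub : (univ.filter fun c => ¬ σ c (Sum.inl e) = Sum.inl e) ⊆
        univ.filter fun c => f c u = v ∨ f c v = u := by
      intro c hc
      simp only [mem_filter, mem_univ, true_and] at hc ⊢
      rcases hx : σ c (Sum.inl e) with e' | x
      · have : M (Sum.inl e) (Sum.inl e') ≠ 0 := by
          rw [← hσ]
          exact card_ne_zero.2 ⟨c, by simpa using hx⟩
        simp only [M, Sum.elim_inl, ne_eq, ite_eq_right_iff, not_forall] at this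
        exact absurd (this.1 ▸ hx) hc
      · have hxe := hσmem c e x hx
        rcases Sym2.mem_iff.1 hxe with rfl | rfl
        · exact Or.inl (hf c e _ _ hx rfl)
        · exact Or.inr (hf c e _ _ hx Sym2.eq_swap)
    have h1 := hσ (Sum.inl e) (Sum.inl e)
    have h2 := card_filter_add_card_filter_not (s := (univ : Finset (Fin a)))
      (fun c => σ c (Sum.inl e) = Sum.inl e)
    simp only [M, Sum.elim_inl, if_true] at h1
    rw [h1, card_univ, Fintype.card_fin] at h2
    refine le_trans ?_ (card_le_card hsub)
    omega

end Decomposition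

section Trails

/-- `v` lies on a cycle of `f` of length at most `T`. -/
def OnShortCycle (f : V → V) (T : ℕ) (v : V) : Prop := ∃ k, 1 ≤ k ∧ k ≤ T ∧ f^[k] v = v

lemma OnShortCycle.iterate {f : V → V} {T : ℕ} {v : V} (h : OnShortCycle f T v) (j : ℕ) :
    OnShortCycle f T (f^[j] v) := by
  obtain ⟨k, hk, hkT, hv⟩ := h
  exact ⟨k, hk, hkT, by rw [← Function.iterate_add_apply, add_comm, Function.iterate_add_apply, hv]⟩

lemma card_adj_le_maxDeg [Fintype V] (G : SimpleGraph V) (u : V) [DecidablePred (G.Adj u)] :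
    (univ.filter (G.Adj u)).card ≤ maxDeg G := by
  refine le_trans (le_of_eq ?_) (le_sup (f := deg G) (mem_univ u))
  rw [deg, ← Fintype.card_coe, ← Nat.card_eq_fintype_card]
  exact Nat.card_congr (Equiv.subtypeEquivRight fun v => by simp)

variable [DecidableEq V]

/-- The first `T` iterates of `v` under `f`. -/
def orbitUpTo (f : V → V) (T : ℕ) (v : V) : Finset V := (range T).image fun k => f^[k] v

open Classical in
/-- The trajectory of `v` under `f`, where every cycle of length at most `T` is contracted to a
single point at which an infinite path is attached. -/
def trail (f : V → V) (T : ℕ) : ℕ → V → Finset V × ℕ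
  | 0, v => if OnShortCycle f T v then (orbitUpTo f T v, 0) else ({v}, 0)
  | t + 1, v => if OnShortCycle f T v then (orbitUpTo f T v, t + 1) else trail f T t (f v)

variable {f : V → V} {T : ℕ} {u v w : V}

lemma orbitUpTo_map (h : OnShortCycle f T v) : orbitUpTo f T (f v) = orbitUpTo f T v := by
  obtain ⟨k, hk, hkT, hv⟩ := h
  ext u
  simp only [orbitUpTo, mem_image, mem_range, ← Function.iterate_succ_apply]
  constructor
  · rintro ⟨j, hj, rfl⟩
    by_cases h : j + 1 < T
    · exact ⟨j + 1, h, rfl⟩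
    · refine ⟨T - k, by omega, ?_⟩
      rw [show j.succ = (T - k) + k by omega, Function.iterate_add_apply, hv]
  · rintro ⟨j, hj, rfl⟩
    rcases j with _ | j
    · exact ⟨k - 1, by omega, by rw [show (k - 1).succ = k by omega, hv]; rfl⟩
    · exact ⟨j, by omega, rfl⟩

lemma trail_of_short (h : OnShortCycle f T v) (t : ℕ) : trail f T t v = (orbitUpTo f T v, t) := by
  cases t <;> simp [trail, h]

lemma trail_map_of_short (h : OnShortCycle f T v) (t : ℕ) :
    trail f T t (f v) = trail f T t v := by
  have h' : OnShortCycle f T (f v) := h.iterate 1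
  rw [trail_of_short h, trail_of_short h', orbitUpTo_map h]

lemma trail_succ (h : ¬ OnShortCycle f T v) (t : ℕ) :
    trail f T (t + 1) v = trail f T t (f v) := by
  simp [trail, h]

lemma trail_zero (h : ¬ OnShortCycle f T v) : trail f T 0 v = ({v}, 0) := by
  simp [trail, h]

lemma trail_snd_le (t : ℕ) : ∀ v, (trail f T t v).2 ≤ t := by
  induction t with
  | zero =>
    intro v
    by_cases h : OnShortCycle f T v
    · simp [trail_of_short h]
    · simp [trail_zero h]
  | succ t ih =>
    intro v
    by_cases h : OnShortCycle f T v
    · simp [trail_of_short h]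
    · rw [trail_succ h]
      exact (ih _).trans t.le_succ

lemma trail_fst_nonempty (hT : 0 < T) (t : ℕ) : ∀ v, (trail f T t v).1.Nonempty := by
  have horb : ∀ v, (orbitUpTo f T v).Nonempty := fun v =>
    ⟨v, mem_image.2 ⟨0, mem_range.2 hT, rfl⟩⟩
  induction t with
  | zero =>
    intro v
    by_cases h : OnShortCycle f T v
    · simpa [trail_of_short h] using horb v
    · simp [trail_zero h]
  | succ t ih =>
    intro v
    by_cases h : OnShortCycle f T v
    · simpa [trail_of_short h] using horb v
    · rw [trail_succ h]
      exact ih _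

lemma exists_iterate_of_mem_trail (t : ℕ) :
    ∀ v, u ∈ (trail f T t v).1 → ∃ k ≤ t + T, f^[k] v = u := by
  have horb : ∀ t v, u ∈ orbitUpTo f T v → ∃ k ≤ t + T, f^[k] v = u := by
    intro t v h
    obtain ⟨k, hk, rfl⟩ := mem_image.1 h
    exact ⟨k, by have := mem_range.1 hk; omega, rfl⟩
  induction t with
  | zero =>
    intro v hu
    by_cases h : OnShortCycle f T v
    · rw [trail_of_short h] at hu
      exact horb _ v hu
    · rw [trail_zero h] at hu
      exact ⟨0, Nat.zero_le _, (mem_singleton.1 hu).symm⟩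
  | succ t ih =>
    intro v hu
    by_cases h : OnShortCycle f T v
    · rw [trail_of_short h] at hu
      exact horb _ v hu
    · rw [trail_succ h] at hu
      obtain ⟨k, hk, hku⟩ := ih _ hu
      exact ⟨k + 1, by omega, hku⟩

lemma iterate_eq_of_mem_trail (hu : ¬ OnShortCycle f T u) (t : ℕ) :
    ∀ v, u ∈ (trail f T t v).1 → f^[t] v = u := by
  have horb : ∀ t v, OnShortCycle f T v → u ∉ (trail f T t v).1 := by
    intro t v h hmem
    rw [trail_of_short h] at hmem
    obtain ⟨k, -, rfl⟩ := mem_image.1 hmem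
    exact hu (h.iterate k)
  induction t with
  | zero =>
    intro v hmem
    by_cases h : OnShortCycle f T v
    · exact absurd hmem (horb _ v h)
    · rw [trail_zero h] at hmem
      exact (mem_singleton.1 hmem).symm
  | succ t ih =>
    intro v hmem
    by_cases h : OnShortCycle f T v
    · exact absurd hmem (horb _ v h)
    · rw [trail_succ h] at hmem
      exact ih _ hmem

lemma trail_ne_of_lt (s : ℕ) : ∀ t v, s < t → t ≤ T → trail f T s v ≠ trail f T t v := by
  induction s with
  | zero =>
    intro t v hst htT heq
    by_cases h : OnShortCycle f T v
    · rw [trail_of_short h, trail_of_short h] at heq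
      exact hst.ne (congrArg Prod.snd heq)
    · rw [trail_zero h] at heq
      have hmem : v ∈ (trail f T t v).1 := heq ▸ mem_singleton_self v
      exact h ⟨t, hst, htT, iterate_eq_of_mem_trail h t v hmem⟩
  | succ s ih =>
    intro t v hst htT heq
    by_cases h : OnShortCycle f T v
    · rw [trail_of_short h, trail_of_short h] at heq
      exact hst.ne (congrArg Prod.snd heq)
    · obtain ⟨t, rfl⟩ : ∃ t', t = t' + 1 := ⟨t - 1, by omega⟩
      rw [trail_succ h, trail_succ h] at heq
      exact ih t (f v) (by omega) (by omega) heq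

lemma trail_injOn {s t : ℕ} (hs : s ≤ T) (ht : t ≤ T) (h : trail f T s v = trail f T t v) :
    s = t := by
  rcases lt_trichotomy s t with hst | hst | hst
  · exact absurd h (trail_ne_of_lt s t v hst ht)
  · exact hst
  · exact absurd h.symm (trail_ne_of_lt t s v hst hs)

variable [Fintype V]

lemma card_iterate_fibre_le {G : SimpleGraph V} (hf : ∀ v, f v = v ∨ G.Adj v (f v)) (k : ℕ) :
    (univ.filter fun w => f^[k] w = u).card ≤ (maxDeg G + 1) ^ k := by
  classical
  induction k with
  | zero =>
    rw [pow_zero, card_le_one]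
    exact fun x hx y hy => (mem_filter.1 hx).2.trans (mem_filter.1 hy).2.symm
  | succ k ih =>
    have hsub : (univ.filter fun w => f^[k + 1] w = u) ⊆
        (univ.filter fun w => f^[k] w = u).biUnion fun x => insert x (univ.filter (G.Adj x)) := by
      intro w hw
      replace hw := (mem_filter.1 hw).2
      rw [Function.iterate_succ_apply] at hw
      simp only [mem_biUnion, mem_filter, mem_univ, true_and, mem_insert]
      refine ⟨f w, hw, ?_⟩
      rcases hf w with h | h
      · exact Or.inl h.symm
      · exact Or.inr h.symm
    calc _ ≤ _ := card_le_card hsub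
      _ ≤ (univ.filter fun w => f^[k] w = u).card * (maxDeg G + 1) :=
          card_biUnion_le_card_mul _ _ _ fun x _ =>
            (card_insert_le _ _).trans (Nat.succ_le_succ (card_adj_le_maxDeg G x))
      _ ≤ (maxDeg G + 1) ^ (k + 1) := by
          rw [pow_succ]
          exact Nat.mul_le_mul_right _ ih

/-- Few trails meet a given trail. -/
lemma card_trails_meeting_le {G : SimpleGraph V} {a : ℕ} {f : Fin a → V → V}
    (hf : ∀ i v, f i v = v ∨ G.Adj v (f i v)) (hT : 0 < T) (v : V) :
    (univ.filter fun w => ∃ i, ∃ s < T, ∃ t < T,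
      trail (f i) T s v = trail (f i) T t w).card ≤
      a * (2 * T) ^ 2 * (maxDeg G + 1) ^ (2 * T) := by
  classical
  let J : Finset (Fin a × ℕ × ℕ) := univ ×ˢ (range (2 * T) ×ˢ range (2 * T))
  have hsub : (univ.filter fun w => ∃ i, ∃ s < T, ∃ t < T,
      trail (f i) T s v = trail (f i) T t w) ⊆
      J.biUnion fun x => univ.filter fun w => (f x.1)^[x.2.2] w = (f x.1)^[x.2.1] v := by
    intro w hw
    simp only [mem_filter, mem_univ, true_and] at hw
    obtain ⟨i, s, hs, t, ht, h⟩ := hw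
    obtain ⟨u, hu⟩ := trail_fst_nonempty (f := f i) hT s v
    obtain ⟨k, hk, rfl⟩ := exists_iterate_of_mem_trail s v hu
    obtain ⟨k', hk', hkk⟩ := exists_iterate_of_mem_trail t w (h ▸ hu)
    simp only [mem_biUnion, mem_filter, mem_univ, true_and]
    exact ⟨(i, k, k'), by simp [J]; omega, hkk⟩
  refine (card_le_card hsub).trans ((card_biUnion_le_card_mul _ _
    ((maxDeg G + 1) ^ (2 * T)) fun x hx => ?_).trans (le_of_eq ?_))
  · simp only [J, mem_product, mem_range] at hx
    exact (card_iterate_fibre_le (hf x.1) _).trans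
      (Nat.pow_le_pow_right (Nat.succ_pos _) hx.2.2.le)
  · simp [J, pow_two]

end Trails

section Labelling

variable {K S : Type*} [Fintype V] [Fintype K] [Fintype S]

/-- If every vertex is close to at most `B` vertices, a set `F` contains many tuples of
pairwise far vertices. -/
lemma card_far_tuples_ge [DecidableEq V] (near : V → V → Prop) [DecidableRel near] {B : ℕ}
    (hB : ∀ v, (univ.filter fun w => near w v).card ≤ B) (F : Finset V) (p q : ℕ) (hpq : p ≤ q) :
    (F.card - q * B) ^ p ≤ (univ.filter fun s : Fin p → V =>
      (∀ j, s j ∈ F) ∧ ∀ i j, i < j → ¬ near (s i) (s j)).card := by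
  induction p with
  | zero => simp
  | succ p ih =>
    rw [card_eq_sum_card_fiberwise (f := Fin.tail) (t := univ.filter fun s : Fin p → V =>
      (∀ j, s j ∈ F) ∧ ∀ i j, i < j → ¬ near (s i) (s j))]
    · rw [pow_succ]
      refine (Nat.mul_le_mul_right _ (ih (by omega))).trans ?_
      rw [← smul_eq_mul]
      refine card_nsmul_le_sum _ _ _ fun s hs => ?_
      simp only [mem_filter, mem_univ, true_and] at hs
      have h1 : F.card - q * B ≤ (F \ (univ.biUnion fun j => univ.filter fun w =>
          near w (s j))).card := by
        refine le_trans ?_ (le_card_sdiff _ _)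
        refine Nat.sub_le_sub_left ?_ _
        refine (card_biUnion_le_card_mul _ _ B fun j _ => hB (s j)).trans ?_
        rw [card_univ, Fintype.card_fin]
        exact Nat.mul_le_mul_right _ (by omega)
      refine h1.trans (card_le_card_of_injOn (fun w => (Fin.cons w s : Fin (p + 1) → V)) ?_ ?_)
      · intro w hw
        simp only [coe_sdiff, coe_biUnion, Set.mem_sdiff, mem_coe, Set.mem_iUnion,
          coe_filter, mem_univ, true_and, Set.mem_ofPred_eq, not_exists] at hw
        simp only [mem_coe, mem_filter, mem_univ, true_and, Fin.tail_cons, and_true]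
        refine ⟨fun j => ?_, fun i j hij => ?_⟩
        · cases j using Fin.cases with
          | zero => exact hw.1
          | succ j => exact hs.1 j
        · cases j using Fin.cases with
          | zero => exact absurd hij (Fin.not_lt_zero i)
          | succ j =>
            cases i using Fin.cases with
            | zero => exact fun h => hw.2 j trivial h
            | succ i => exact hs.2 i j (Fin.succ_lt_succ_iff.1 hij)
      · intro w _ w' _ h
        exact (Fin.cons_inj.1 h).1
    · intro s hs
      simp only [coe_filter, mem_univ, true_and, Set.mem_ofPred_eq] at hs ⊢
      exact ⟨fun j => hs.1 j.succ, fun i j hij => hs.2 _ _ (Fin.succ_lt_succ_iff.2 hij)⟩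

/-- The number of labellings which are constant along `q + 1` disjoint copies of `K`. -/
lemma card_constant_labellings_le [DecidableEq S] (q : ℕ) (σ : Fin (q + 1) → K → S)
    (hσ : ∀ i j k l, σ i k = σ j l → i = j ∧ k = l) :
    (univ.filter fun y : S → Bool => ∀ j k, y (σ j k) = y (σ 0 k)).card *
      2 ^ (Fintype.card K * q) ≤ 2 ^ Fintype.card S := by
  let g : Fin q × K → S := fun x => σ x.1.succ x.2
  have hg : Function.Injective g := by
    rintro ⟨i, k⟩ ⟨j, l⟩ h
    have := hσ _ _ _ _ h
    simpa using this
  let U : Finset S := univ.image g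
  have hU : U.card = Fintype.card K * q := by
    rw [card_image_of_injective _ hg, card_univ, Fintype.card_prod, Fintype.card_fin, mul_comm]
  have hle : (univ.filter fun y : S → Bool => ∀ j k, y (σ j k) = y (σ 0 k)).card ≤
      2 ^ (Uᶜ).card := by
    have : 2 ^ (Uᶜ).card = (univ : Finset ((Uᶜ : Finset S) → Bool)).card := by
      simp [card_compl]
    rw [this]
    refine card_le_card_of_injOn (fun y s => y s.1) (fun _ _ => mem_coe.2 (mem_univ _)) ?_
    intro y hy y' hy' h
    simp only [coe_filter, mem_univ, true_and, Set.mem_ofPred_eq] at hy hy'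
    have hout : ∀ s ∉ U, y s = y' s := fun s hs => congrFun h ⟨s, mem_compl.2 hs⟩
    funext s
    by_cases hs : s ∈ U
    · obtain ⟨⟨j, k⟩, -, rfl⟩ := mem_image.1 hs
      simp only [g]
      rw [hy, hy']
      refine hout _ fun h0 => ?_
      obtain ⟨⟨i, l⟩, -, h1⟩ := mem_image.1 h0
      exact Fin.succ_ne_zero i (hσ _ _ _ _ h1).1
    · exact hout s hs
  calc _ ≤ 2 ^ (Uᶜ).card * 2 ^ U.card := by rw [hU]; exact Nat.mul_le_mul_right _ hle
    _ = 2 ^ Fintype.card S := by rw [← pow_add, card_compl_add_card]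

/-- Some labelling distributes the vertices almost evenly among the words read along `code`. -/
theorem exists_balanced_labelling (code : V → K → S) (hcode : ∀ v, Function.Injective (code v))
    {B : ℕ} (hB : ∀ v, Nat.card {w // ∃ k l, code v k = code w l} ≤ B) (q : ℕ) :
    ∃ y : S → Bool, ∀ F : Finset V, (∀ u ∈ F, ∀ v ∈ F, ∀ k, y (code u k) = y (code v k)) →
      (F.card - (q + 1) * B) ^ (q + 1) * 2 ^ (Fintype.card K * q) ≤
        Fintype.card V ^ (q + 1) := by
  classical
  let near (w v : V) : Prop := ∃ k l, code v k = code w l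
  have hnear : ∀ v, (univ.filter fun w => near w v).card ≤ B := by
    intro v
    refine le_trans (le_of_eq ?_) (hB v)
    rw [← Fintype.card_subtype, Nat.card_eq_fintype_card]
  let far : Finset (Fin (q + 1) → V) := univ.filter fun s => ∀ i j, i < j → ¬ near (s i) (s j)
  let mono (y : S → Bool) (s : Fin (q + 1) → V) : Prop :=
    ∀ j k, y (code (s j) k) = y (code (s 0) k)
  by_contra! hcon
  choose F hF hcard using hcon
  have hlow : ∀ y, Fintype.card V ^ (q + 1) <
      (far.filter (mono y)).card * 2 ^ (Fintype.card K * q) := by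
    intro y
    refine (hcard y).trans_le (Nat.mul_le_mul_right _ ?_)
    refine (card_far_tuples_ge near hnear (F y) (q + 1) (q + 1) le_rfl).trans (card_le_card ?_)
    intro s hs
    simp only [mem_filter, mem_univ, true_and, far] at hs ⊢
    exact ⟨hs.2, fun j k => hF y _ (hs.1 j) _ (hs.1 0) k⟩
  have h1 : ∑ _y : S → Bool, Fintype.card V ^ (q + 1) <
      ∑ y : S → Bool, (far.filter (mono y)).card * 2 ^ (Fintype.card K * q) :=
    sum_lt_sum_of_nonempty univ_nonempty fun y _ => hlow y
  have h2 : ∑ y : S → Bool, (far.filter (mono y)).card * 2 ^ (Fintype.card K * q) =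
      ∑ s ∈ far, (univ.filter fun y => mono y s).card * 2 ^ (Fintype.card K * q) := by
    simp only [card_filter, sum_mul]
    exact sum_comm
  have h3 : ∀ s ∈ far, (univ.filter fun y => mono y s).card * 2 ^ (Fintype.card K * q) ≤
      2 ^ Fintype.card S := by
    intro s hs
    refine card_constant_labellings_le q (fun j => code (s j)) fun i j k l h => ?_
    have hs' := (mem_filter.1 hs).2
    rcases lt_trichotomy i j with hij | rfl | hij
    · exact absurd ⟨l, k, h.symm⟩ (hs' i j hij)
    · exact ⟨rfl, hcode _ h⟩
    · exact absurd ⟨k, l, h⟩ (hs' j i hij)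
  have h4 := sum_le_sum h3
  have h5 : far.card ≤ Fintype.card V ^ (q + 1) := (card_le_univ _).trans (by simp)
  rw [← h2] at h4
  simp only [sum_const, card_univ, smul_eq_mul, Fintype.card_fun, Fintype.card_bool] at h1 h4
  have h6 := Nat.mul_le_mul_right (2 ^ Fintype.card S) h5
  linarith

end Labelling

section Words

/-- The words agreeing with `h` outside of `U`. -/
def wordsOff (h : ℕ → Bool) (U : Finset ℕ) : Finset (ℕ → Bool) := by
  classical exact U.powerset.image fun s t => if t ∈ U then decide (t ∈ s) else h t

lemma mem_wordsOff {g h : ℕ → Bool} {U : Finset ℕ} (H : ∀ t ∉ U, g t = h t) :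
    g ∈ wordsOff h U := by
  classical
  rw [wordsOff, mem_image]
  refine ⟨U.filter fun t => g t = true, mem_powerset.2 (filter_subset _ _), ?_⟩
  funext t
  by_cases ht : t ∈ U
  · simp [ht]
  · simp [ht, H t ht]

lemma card_wordsOff_le (h : ℕ → Bool) (U : Finset ℕ) : (wordsOff h U).card ≤ 2 ^ U.card := by
  classical
  rw [wordsOff]
  exact card_image_le.trans (card_powerset U).le

/-- The words of length `m` which can arise from a word with prefix `h` of length `m - 1`
by doing nothing, a left shift or a right shift. -/
def shiftedWords (h : ℕ → Bool) (m : ℕ) : Finset (ℕ → Bool) := by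
  classical exact wordsOff h {m - 1} ∪ (wordsOff (fun t => h (t + 1)) {m - 2, m - 1} ∪
    wordsOff (fun t => if t < m then h (t - 1) else false) {0})

lemma card_shiftedWords_le (h : ℕ → Bool) (m : ℕ) : (shiftedWords h m).card ≤ 8 := by
  classical
  rw [shiftedWords]
  have h1 := card_wordsOff_le h {m - 1}
  have h2 := card_wordsOff_le (fun t => h (t + 1)) {m - 2, m - 1}
  have h3 := card_wordsOff_le (fun t => if t < m then h (t - 1) else false) {0}
  have h4 := h2.trans (Nat.pow_le_pow_right two_pos card_le_two)
  rw [card_singleton] at h1 h3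
  refine (card_union_le _ _).trans ((Nat.add_le_add_left (card_union_le _ _) _).trans ?_)
  omega

/-- The prefix of length `m` of `x`, padded by `false`. -/
def prefixWord (x : ℕ → Bool) (m : ℕ) : ℕ → Bool := fun t => if t < m then x t else false

lemma prefixWord_mem_shiftedWords {x x' : ℕ → Bool} (m : ℕ)
    (H : (∀ t, x t = x' t) ∨ (∀ t, x t = x' (t + 1)) ∨ ∀ t, x (t + 1) = x' t) :
    prefixWord x m ∈ shiftedWords (prefixWord x' (m - 1)) m := by
  classical
  rw [shiftedWords, mem_union, mem_union]
  rcases H with H | H | H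
  · refine Or.inl (mem_wordsOff fun t ht => ?_)
    rw [mem_singleton] at ht
    by_cases h : t < m
    · simp [prefixWord, h, show t < m - 1 by omega, H]
    · simp [prefixWord, h, show ¬ t < m - 1 by omega]
  · refine Or.inr (Or.inl (mem_wordsOff fun t ht => ?_))
    simp only [mem_insert, mem_singleton, not_or] at ht
    by_cases h : t < m
    · simp [prefixWord, h, show t + 1 < m - 1 by omega, H]
    · simp [prefixWord, h, show ¬ t + 1 < m - 1 by omega]
  · refine Or.inr (Or.inr (mem_wordsOff fun t ht => ?_))
    obtain ⟨s, rfl⟩ : ∃ s, t = s + 1 := ⟨t - 1, by rw [mem_singleton] at ht; omega⟩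
    by_cases h : s + 1 < m
    · simp [prefixWord, h, show s < m - 1 by omega, H]
    · simp [prefixWord, h]

end Words

section Core

variable [Fintype V]

/-- Number of words met by the neighbourhood of a class of the next coarser word colouring. -/
lemma card_image_words_nbhd_le (G : SimpleGraph V) {a b Z : ℕ} (r : Fin a → ℕ)
    (x : Fin a → V → ℕ → Bool)
    (hx : ∀ u v, G.Adj u v → b ≤ Nat.card {i // (∀ t, x i v t = x i u t) ∨
      (∀ t, x i v t = x i u (t + 1)) ∨ ∀ t, x i v (t + 1) = x i u t})
    (hZ : ∀ I : Finset (Fin a), I.card = b → 2 ^ (∑ i ∈ Iᶜ, r i) ≤ Z)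
    [DecidableEq (Fin a → ℕ → Bool)] (C : Finset V) (u₀ : V) (j : ℕ)
    (hC : ∀ u ∈ C, ∀ i, prefixWord (x i u₀) (r i - (j + 1)) = prefixWord (x i u) (r i - (j + 1))) :
    ((nbhd G C).image fun v i => prefixWord (x i v) (r i - j)).card ≤
      a.choose b * (8 ^ b * Z) := by
  classical
  let opts (I : Finset (Fin a)) (i : Fin a) : Finset (ℕ → Bool) :=
    if i ∈ I then shiftedWords (prefixWord (x i u₀) (r i - (j + 1))) (r i - j)
    else wordsOff (fun _ => false) (range (r i - j))
  have hsub : ((nbhd G C).image fun v i => prefixWord (x i v) (r i - j)) ⊆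
      (powersetCard b univ).biUnion fun I => Fintype.piFinset (opts I) := by
    intro g hg
    obtain ⟨v, hv, rfl⟩ := mem_image.1 hg
    obtain ⟨u, hu, huv⟩ := mem_nbhd.1 hv
    have hb := hx u v huv
    rw [Nat.card_eq_fintype_card, Fintype.card_subtype] at hb
    obtain ⟨I, hI, hIb⟩ := exists_subset_card_eq hb
    refine mem_biUnion.2 ⟨I, mem_powersetCard.2 ⟨subset_univ _, hIb⟩, ?_⟩
    rw [Fintype.mem_piFinset]
    intro i
    by_cases hi : i ∈ I
    · simp only [opts, if_pos hi, hC u hu]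
      exact prefixWord_mem_shiftedWords _ (mem_filter.1 (hI hi)).2
    · simp only [opts, if_neg hi]
      refine mem_wordsOff fun t ht => ?_
      rw [mem_range] at ht
      simp [prefixWord, ht]
  refine (card_le_card hsub).trans ((card_biUnion_le_card_mul _ _ (8 ^ b * Z) fun I hI => ?_).trans
    (le_of_eq (by simp)))
  have hIb := (mem_powersetCard.1 hI).2
  rw [Fintype.card_piFinset, ← prod_mul_prod_compl I]
  refine Nat.mul_le_mul ?_ ?_
  · rw [← hIb]
    refine prod_le_pow_card _ _ _ fun i hi => ?_
    simp only [opts, if_pos hi]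
    exact card_shiftedWords_le _ _
  · refine le_trans ?_ (hZ I hIb)
    rw [← prod_pow_eq_pow_sum]
    refine prod_le_prod' fun i hi => ?_
    simp only [opts, if_neg (mem_compl.1 hi)]
    refine (card_wordsOff_le _ _).trans (Nat.pow_le_pow_right two_pos ?_)
    simp

variable [DecidableEq V]

lemma card_nbhd_le (G : SimpleGraph V) (C : Finset V) :
    (nbhd G C).card ≤ maxDeg G * C.card := by
  classical
  have : nbhd G C ⊆ C.biUnion fun u => univ.filter (G.Adj u) := by
    intro v hv
    obtain ⟨u, hu, huv⟩ := mem_nbhd.1 hv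
    exact mem_biUnion.2 ⟨u, hu, by simpa using huv⟩
  rw [mul_comm]
  exact (card_le_card this).trans
    (card_biUnion_le_card_mul _ _ _ fun u _ => card_adj_le_maxDeg G u)

/-- The combinatorial bound on the sparse twin-width in terms of a `b`-fold cover by `a`
functional graphs and words of lengths `r i`. -/
theorem stww_le_of_cover (G : SimpleGraph V) {a b T q M Z : ℕ} (hab : b ≤ a)
    (hmad : mad G * b ≤ 2 * a) (hT : 0 < T) (r : Fin a → ℕ) (hr : ∀ i, r i ≤ T)
    (hM : ∀ m : ℕ, (m - (q + 1) * (a * (2 * T) ^ 2 * (maxDeg G + 1) ^ (2 * T))) ^ (q + 1) *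
      2 ^ ((∑ i, r i) * q) ≤ Fintype.card V ^ (q + 1) → m ≤ M)
    (hZ : ∀ I : Finset (Fin a), I.card = b → 2 ^ (∑ i ∈ Iᶜ, r i) ≤ Z) :
    stww G ≤ max (maxDeg G * M) (a.choose b * (8 ^ b * Z)) := by
  classical
  obtain ⟨f, hf, hcov⟩ := exists_functional_cover G hab hmad
  have hlt (v : V) (k : Σ i : Fin a, Fin (r i)) : (trail (f k.1) T k.2 v).2 < T :=
    (trail_snd_le _ _).trans_lt (k.2.2.trans_le (hr _))
  let code (v : V) (k : Σ i : Fin a, Fin (r i)) : Fin a × Finset V × Fin T :=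
    (k.1, (trail (f k.1) T k.2 v).1, ⟨(trail (f k.1) T k.2 v).2, hlt v k⟩)
  have hcode_eq : ∀ v w k l, code v k = code w l →
      k.1 = l.1 ∧ trail (f k.1) T k.2 v = trail (f l.1) T l.2 w := by
    intro v w k l h
    simp only [code, Prod.mk.injEq, Fin.mk.injEq] at h
    exact ⟨h.1, Prod.ext h.2.1 h.2.2⟩
  have hcode (v : V) : Function.Injective (code v) := by
    rintro ⟨i, s⟩ ⟨j, t⟩ h
    obtain ⟨h1, h2⟩ := hcode_eq _ _ _ _ h
    simp only at h1
    subst h1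
    have := trail_injOn (s.2.le.trans (hr i)) (t.2.le.trans (hr i)) h2
    rw [Fin.ext this]
  obtain ⟨y, hy⟩ := exists_balanced_labelling (B := a * (2 * T) ^ 2 * (maxDeg G + 1) ^ (2 * T))
    code hcode (fun v => by
      rw [Nat.card_eq_fintype_card, Fintype.card_subtype]
      refine le_trans (card_le_card ?_) (card_trails_meeting_le hf hT v)
      intro w hw
      simp only [mem_filter, mem_univ, true_and] at hw ⊢
      obtain ⟨⟨i, s⟩, ⟨j, t⟩, h⟩ := hw
      obtain ⟨h1, h2⟩ := hcode_eq _ _ _ _ h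
      simp only at h1
      subst h1
      exact ⟨i, s, s.2.trans_le (hr i), t, t.2.trans_le (hr i), h2⟩) q
  let L (i : Fin a) (z : Finset V × ℕ) : Bool := if h : z.2 < T then y (i, z.1, ⟨z.2, h⟩) else false
  let x (i : Fin a) (v : V) (t : ℕ) : Bool := L i (trail (f i) T t v)
  have hLy : ∀ v k, y (code v k) = x k.1 v k.2 := by
    intro v k
    simp only [x, L, code]
    rw [dif_pos (hlt v k)]
  refine stww_le_of_chain G (fun j v i => prefixWord (x i v) (r i - j)) T _ ?_ ?_ ?_ ?_
  · intro j u v h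
    funext i t
    have := congrFun (congrFun h i) t
    simp only [prefixWord] at this ⊢
    split_ifs with ht
    · rwa [if_pos (by omega), if_pos (by omega)] at this
    · rfl
  · intro u v
    funext i t
    simp [prefixWord, Nat.sub_eq_zero_of_le (hr i)]
  · intro u
    refine le_max_of_le_left ((card_nbhd_le G _).trans (Nat.mul_le_mul_left _ (hM _ ?_)))
    have hcard : Fintype.card (Σ i : Fin a, Fin (r i)) = ∑ i, r i := by simp
    rw [← hcard]
    refine hy _ fun v hv w hw k => ?_
    replace hv := (mem_filter.1 hv).2
    replace hw := (mem_filter.1 hw).2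
    have := congrFun (congrFun (hv.symm.trans hw) k.1) k.2
    rw [hLy, hLy]
    simpa [prefixWord] using this
  · intro j u
    refine le_max_of_le_right (card_image_words_nbhd_le G r x ?_ hZ _ u j ?_)
    · intro u v huv
      refine (hcov u v huv).trans ?_
      rw [Nat.card_eq_fintype_card, Fintype.card_subtype]
      refine card_le_card fun i hi => ?_
      simp only [mem_filter, mem_univ, true_and] at hi ⊢
      rcases hi with rfl | rfl
      · by_cases hs : OnShortCycle (f i) T u
        · exact Or.inl fun t => congrArg (L i) (trail_map_of_short hs t)
        · exact Or.inr (Or.inl fun t => congrArg (L i) (trail_succ hs t).symm)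
      · by_cases hs : OnShortCycle (f i) T v
        · exact Or.inl fun t => congrArg (L i) (trail_map_of_short hs t).symm
        · exact Or.inr (Or.inr fun t => congrArg (L i) (trail_succ hs t))
    · intro v hv i
      exact congrFun (mem_filter.1 hv).2 i

end Core

section Estimates

lemma exists_balanced_lengths {a : ℕ} (ha : 0 < a) (R : ℕ) :
    ∃ r : Fin a → ℕ, ∑ i, r i = R ∧ ∀ i, R / a ≤ r i ∧ r i ≤ R / a + 1 := by
  refine ⟨fun i => R / a + if (i : ℕ) < R % a then 1 else 0, ?_, fun i => ?_⟩
  · have h : (univ.filter fun i : Fin a => (i : ℕ) < R % a).card = R % a := by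
      have := Fin.card_filter_val_lt (n := a) (m := R % a)
      rw [this, min_eq_right (Nat.mod_lt _ ha).le]
    rw [sum_add_distrib, sum_boole, h]
    simp [Nat.div_add_mod]
  · simp only
    split_ifs <;> omega

lemma sum_compl_le_of_le {a b ρ R : ℕ} {r : Fin a → ℕ} (hsum : ∑ i, r i = R) (hr : ∀ i, ρ ≤ r i)
    {I : Finset (Fin a)} (hI : I.card = b) : ∑ i ∈ Iᶜ, r i ≤ R - b * ρ := by
  have h1 := sum_add_sum_compl I r
  have h2 : I.card • ρ ≤ ∑ i ∈ I, r i := card_nsmul_le_sum _ _ _ fun i _ => hr i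
  rw [hI, smul_eq_mul] at h2
  omega

lemma two_pow_floor_bounds {x : ℝ} (hx : 0 ≤ x) :
    ((2 : ℝ) ^ ⌊x / Real.log 2⌋₊ ≤ Real.exp x) ∧
      Real.exp x ≤ 2 * (2 : ℝ) ^ ⌊x / Real.log 2⌋₊ := by
  have h2 : (0 : ℝ) < Real.log 2 := Real.log_pos one_lt_two
  have hpow : ∀ k : ℕ, (2 : ℝ) ^ k = Real.exp (k * Real.log 2) := fun k => by
    rw [Real.exp_nat_mul, Real.exp_log two_pos]
  constructor
  · rw [hpow, Real.exp_le_exp, ← le_div_iff₀ h2]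
    exact Nat.floor_le (div_nonneg hx h2.le)
  · rw [← pow_succ', hpow, Real.exp_le_exp, ← div_le_iff₀ h2]
    push_cast
    exact (Nat.lt_floor_add_one _).le

/-- The moment inequality satisfied by a class of size `m` bounds `m`. -/
lemma class_size_le {α β ℓ : ℝ} {n m X R q : ℕ} (hn : (n : ℝ) = Real.exp ℓ) (hαβ : α + β = 1)
    (hβ : β ≤ 1) (hℓ : 0 ≤ ℓ) (hq : ℓ ≤ q + 1) (hX : (X : ℝ) ≤ Real.exp (α * ℓ))
    (hR : (2 : ℝ) ^ R ≤ Real.exp (β * ℓ)) (hR' : Real.exp (β * ℓ) ≤ 2 * (2 : ℝ) ^ R)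
    (h : (m - X) ^ (q + 1) * 2 ^ (R * q) ≤ n ^ (q + 1)) : (m : ℝ) ≤ 7 * Real.exp (α * ℓ) := by
  have h' : (((m - X : ℕ) : ℝ)) ^ (q + 1) * 2 ^ (R * q) ≤ (n : ℝ) ^ (q + 1) := by exact_mod_cast h
  have hRn : (2 : ℝ) ^ R ≤ Real.exp 1 ^ (q + 1) := by
    rw [← Real.exp_nat_mul]
    refine hR.trans (Real.exp_le_exp.2 ?_)
    push_cast
    nlinarith
  have h1 : (((m - X : ℕ) : ℝ) * 2 ^ R) ^ (q + 1) ≤ (Real.exp 1 * n) ^ (q + 1) := by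
    calc (((m - X : ℕ) : ℝ) * 2 ^ R) ^ (q + 1)
        = ((m - X : ℕ) : ℝ) ^ (q + 1) * 2 ^ (R * q) * 2 ^ R := by
          rw [mul_pow, ← pow_mul]; ring
      _ ≤ (n : ℝ) ^ (q + 1) * Real.exp 1 ^ (q + 1) :=
          mul_le_mul h' hRn (by positivity) (by positivity)
      _ = _ := by rw [mul_pow, mul_comm]
  have h2 : ((m - X : ℕ) : ℝ) * 2 ^ R ≤ Real.exp 1 * n :=
    le_of_pow_le_pow_left₀ (Nat.succ_ne_zero q) (by positivity) h1
  have h3 : ((m - X : ℕ) : ℝ) * Real.exp (β * ℓ) ≤ 6 * Real.exp (α * ℓ) * Real.exp (β * ℓ) := by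
    have h4 : Real.exp (α * ℓ) * Real.exp (β * ℓ) = n := by
      rw [hn, ← Real.exp_add, ← add_mul, hαβ, one_mul]
    have h5 := Real.exp_one_lt_d9
    have h6 : (0 : ℝ) ≤ n := Nat.cast_nonneg n
    have h7 : (0 : ℝ) ≤ ((m - X : ℕ) : ℝ) := Nat.cast_nonneg _
    rw [mul_assoc 6, h4]
    nlinarith
  have h8 := le_of_mul_le_mul_right h3 (Real.exp_pos _)
  have h9 : (m : ℝ) ≤ ((m - X : ℕ) : ℝ) + X := by exact_mod_cast (by omega : m ≤ m - X + X)
  linarith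

/-- The number of vertices with a trail near a given one is negligible. -/
lemma near_count_le {s d : ℝ} {a q T Δ : ℕ} (hs : 100 ≤ s) (hd : 2 + 1 / s ≤ d)
    (ha : (a : ℝ) ≤ s ^ 6) (hq : (q : ℝ) + 1 ≤ 2 * s ^ 6) (hT : (T : ℝ) ≤ 4 * s ^ 3)
    (hΔ : 1 ≤ Δ) (hΔs : Real.log Δ ≤ s) :
    (((q + 1) * (a * (2 * T) ^ 2 * (Δ + 1) ^ (2 * T)) : ℕ) : ℝ) ≤
      Real.exp ((d - 2) / (2 * d - 2) * s ^ 6) := by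
  have hs0 : 0 < s := by linarith
  have hΔ' : (1 : ℝ) ≤ Δ := by exact_mod_cast hΔ
  have hexp : s ^ 5 / 4 ≤ (d - 2) / (2 * d - 2) * s ^ 6 := by
    have h1 : 1 ≤ s * (d - 2) := by
      have := mul_le_mul_of_nonneg_left hd hs0.le
      have h2 : s * (1 / s) = 1 := by field_simp
      nlinarith
    have h0 : 0 < d - 2 := by
      have : 0 < 1 / s := by positivity
      linarith
    rw [div_mul_eq_mul_div, le_div_iff₀ (by linarith)]
    have h3 : 2 * d - 2 ≤ 4 * s * (d - 2) := by nlinarith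
    have := mul_le_mul_of_nonneg_left h3 (show 0 ≤ s ^ 5 / 4 by positivity)
    calc _ ≤ _ := this
      _ = _ := by ring
  have hpoly : ((q : ℝ) + 1) * (a * (2 * T) ^ 2) ≤ Real.exp (26 * s) := by
    have hTT : (2 * (T : ℝ)) ^ 2 ≤ (8 * s ^ 3) ^ 2 :=
      pow_le_pow_left₀ (by positivity) (by linarith) 2
    have h1 : ((q : ℝ) + 1) * (a * (2 * T) ^ 2) ≤ 2 * s ^ 6 * (s ^ 6 * (8 * s ^ 3) ^ 2) := by
      gcongr
    have h2 : 2 * s ^ 6 * (s ^ 6 * (8 * s ^ 3) ^ 2) ≤ s ^ 26 := by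
      have : (128 : ℝ) ≤ s ^ 8 := by
        have : (100 : ℝ) ^ 8 ≤ s ^ 8 := pow_le_pow_left₀ (by norm_num) hs 8
        linarith
      have := mul_le_mul_of_nonneg_left this (show 0 ≤ s ^ 18 by positivity)
      calc _ = s ^ 18 * 128 := by ring
        _ ≤ _ := this
        _ = _ := by ring
    have h3 : s ≤ Real.exp s := by linarith [Real.add_one_le_exp s]
    have h4 : Real.exp (26 * s) = Real.exp s ^ 26 := by
      rw [← Real.exp_nat_mul]; norm_num
    rw [h4]
    exact (h1.trans h2).trans (pow_le_pow_left₀ hs0.le h3 26)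
  have hball : ((Δ : ℝ) + 1) ^ (2 * T) ≤ Real.exp (16 * s ^ 4) := by
    have h1 : (Δ : ℝ) + 1 ≤ Real.exp (2 * s) := by
      have h2 : (Δ : ℝ) ≤ Real.exp s := by
        rw [← Real.log_le_iff_le_exp (by linarith)]; exact hΔs
      have h3 : 2 ≤ Real.exp s := by linarith [Real.add_one_le_exp s]
      have h4 : Real.exp (2 * s) = Real.exp s * Real.exp s := by rw [← Real.exp_add]; ring_nf
      rw [h4]
      nlinarith
    refine (pow_le_pow_left₀ (by linarith) h1 _).trans ?_
    rw [← Real.exp_nat_mul, Real.exp_le_exp]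
    push_cast
    calc 2 * (T : ℝ) * (2 * s) ≤ 2 * (4 * s ^ 3) * (2 * s) := by gcongr
      _ = _ := by ring
  push_cast
  calc ((q : ℝ) + 1) * (a * (2 * T) ^ 2 * (Δ + 1) ^ (2 * T))
      = ((q : ℝ) + 1) * (a * (2 * T) ^ 2) * (Δ + 1) ^ (2 * T) := by ring
    _ ≤ Real.exp (26 * s) * Real.exp (16 * s ^ 4) := by gcongr
    _ = Real.exp (26 * s + 16 * s ^ 4) := (Real.exp_add _ _).symm
    _ ≤ _ := Real.exp_le_exp.2 ?_
  refine le_trans ?_ hexp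
  have h1 : s ≤ s ^ 4 := by
    have : 1 ≤ s ^ 3 := one_le_pow₀ (by linarith)
    nlinarith
  have h2 : 100 * s ^ 4 ≤ s ^ 5 := by
    have := mul_le_mul_of_nonneg_right hs (show 0 ≤ s ^ 4 by positivity)
    calc _ ≤ _ := this
      _ = _ := by ring
  have h3 : 100 * s ≤ s ^ 4 := by
    have : 100 ≤ s ^ 3 := by nlinarith [sq_nonneg s, one_le_pow₀ (n := 2) (show 1 ≤ s by linarith)]
    nlinarith
  linarith

/-- The size of the free part of a word, in terms of the parameters. -/
lemma free_length_le {x d : ℝ} {a b R : ℕ} (hd : 2 ≤ d) (hb : 0 < b) (hab : b ≤ a)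
    (ha : (a : ℝ) ≤ b * d / 2 + 1) (hR : R * Real.log 2 ≤ d / (2 * d - 2) * x) (hx : 0 ≤ x) :
    ((R - b * (R / a) : ℕ) : ℝ) * Real.log 2 ≤
      (d - 2) / (2 * d - 2) * x + b * Real.log 2 + 4 * x / (b * d ^ 2) := by
  have hb' : (0 : ℝ) < b := by exact_mod_cast hb
  have ha' : (0 : ℝ) < a := by exact_mod_cast hb.trans_le hab
  have hab' : (b : ℝ) ≤ a := by exact_mod_cast hab
  have hl : (0 : ℝ) < Real.log 2 := Real.log_pos one_lt_two
  have hle : b * (R / a) ≤ R := (Nat.mul_le_mul_right _ hab).trans (Nat.mul_div_le R a)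
  have hρ : (R : ℝ) / a ≤ ((R / a : ℕ) : ℝ) + 1 := by
    rw [div_le_iff₀ ha']
    exact_mod_cast (Nat.lt_mul_of_div_lt (Nat.lt_succ_self (R / a)) (hb.trans_le hab)).le
  rw [Nat.cast_sub hle]
  push_cast
  have h1 : (R : ℝ) - b * ((R / a : ℕ) : ℝ) ≤ R * (1 - b / a) + b := by
    have := mul_le_mul_of_nonneg_left hρ hb'.le
    have h2 : (R : ℝ) * (1 - b / a) = R - b * (R / a) := by ring
    linarith
  have h3 : 0 ≤ 1 - (b : ℝ) / a := by
    rw [sub_nonneg, div_le_one ha']; exact hab'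
  have h4 : 1 - (b : ℝ) / a ≤ 1 - 2 / d + 4 / (b * d ^ 2) := by
    have h5 : (b : ℝ) / (b * d / 2 + 1) ≤ b / a := by gcongr
    have h6 : 2 / d - 4 / (b * d ^ 2) ≤ (b : ℝ) / (b * d / 2 + 1) := by
      rw [div_sub_div _ _ (by positivity) (by positivity),
        div_le_div_iff₀ (by positivity) (by positivity)]
      have : 0 < d := by linarith
      have h7 : 0 < (b : ℝ) * d := by positivity
      nlinarith [h7, this]
    linarith
  have hβ0 : 0 ≤ d / (2 * d - 2) := div_nonneg (by linarith) (by linarith)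
  have hβ1 : d / (2 * d - 2) ≤ 1 := by
    rw [div_le_one (by linarith)]; linarith
  have hβα : d / (2 * d - 2) * (1 - 2 / d) = (d - 2) / (2 * d - 2) := by
    have : d ≠ 0 := by linarith
    have : 2 * d - 2 ≠ 0 := by linarith
    field_simp
  have h8 : R * Real.log 2 * (1 - (b : ℝ) / a) ≤
      d / (2 * d - 2) * x * (1 - 2 / d + 4 / (b * d ^ 2)) :=
    mul_le_mul hR h4 h3 (by positivity)
  have h9 : d / (2 * d - 2) * (x * (4 / (b * d ^ 2))) ≤ 4 * x / (b * d ^ 2) := by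
    calc _ ≤ 1 * (x * (4 / (b * d ^ 2))) := by gcongr
      _ = _ := by ring
  calc _ ≤ ((R : ℝ) * (1 - b / a) + b) * Real.log 2 := by gcongr
    _ = R * Real.log 2 * (1 - (b : ℝ) / a) + b * Real.log 2 := by ring
    _ ≤ d / (2 * d - 2) * x * (1 - 2 / d + 4 / (b * d ^ 2)) + b * Real.log 2 := by gcongr
    _ = d / (2 * d - 2) * (1 - 2 / d) * x + d / (2 * d - 2) * (x * (4 / (b * d ^ 2))) +
        b * Real.log 2 := by ring
    _ ≤ _ := by rw [hβα]; linarith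


/-- The degree of the quotients at the later stages, in terms of the parameters. -/
lemma choose_mul_le {s d : ℝ} {a b R : ℕ} (hs : 100 ≤ s) (hd : 2 ≤ d) (hb : 0 < b) (hab : b ≤ a)
    (hb1 : s ^ 3 / d ≤ b) (hb2 : (b : ℝ) ≤ s ^ 3 / d + 1) (ha : (a : ℝ) ≤ b * d / 2 + 1)
    (ha6 : (a : ℝ) ≤ s ^ 6) (hR : R * Real.log 2 ≤ d / (2 * d - 2) * s ^ 6) :
    ((a.choose b * (8 ^ b * 2 ^ (R - b * (R / a))) : ℕ) : ℝ) ≤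
      Real.exp ((d - 2) / (2 * d - 2) * s ^ 6 +
        10 * (d⁻¹ * s ^ 3 * Real.log (s ^ 6) + Real.log d)) := by
  have hs0 : 0 < s := by linarith
  have hd0 : 0 < d := by linarith
  have hb' : (0 : ℝ) < b := by exact_mod_cast hb
  have hpow : ∀ k : ℕ, (2 : ℝ) ^ k = Real.exp (k * Real.log 2) := fun k => by
    rw [Real.exp_nat_mul, Real.exp_log two_pos]
  set L := Real.log (s ^ 6) with hLdef
  have hL : 4 * Real.log 2 ≤ L := by
    have h1 : 4 * Real.log 2 = Real.log (2 ^ 4) := by rw [Real.log_pow]; norm_num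
    rw [h1]
    refine Real.log_le_log (by norm_num) ?_
    have : (100 : ℝ) ^ 6 ≤ s ^ 6 := pow_le_pow_left₀ (by norm_num) hs 6
    linarith
  have hl2 := Real.log_two_gt_d9
  have hL1 : 1 ≤ L := by linarith
  have hu : 0 ≤ d⁻¹ * s ^ 3 := by positivity
  have hY : d⁻¹ * s ^ 3 ≤ d⁻¹ * s ^ 3 * L := le_mul_of_one_le_right hu hL1
  have hlogd : 0 ≤ Real.log d := Real.log_nonneg (by linarith)
  have hLY : L ≤ 2 * (d⁻¹ * s ^ 3 * L) + 2 * Real.log d := by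
    rcases le_total (s ^ 3) d with h | h
    · have h1 : Real.log (s ^ 3) ≤ Real.log d := Real.log_le_log (by positivity) h
      have h2 : L = 2 * Real.log (s ^ 3) := by
        rw [hLdef, Real.log_pow, Real.log_pow]; push_cast; ring
      have := mul_nonneg hu (zero_le_one.trans hL1)
      linarith
    · have h1 : 1 ≤ d⁻¹ * s ^ 3 := by
        rw [inv_mul_eq_div, le_div_iff₀ hd0]; linarith
      have := mul_le_mul_of_nonneg_right h1 (zero_le_one.trans hL1)
      linarith
  have hchoose : ((a.choose b : ℕ) : ℝ) ≤ Real.exp (b * L) := by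
    have h1 : ((a.choose b : ℕ) : ℝ) ≤ (a : ℝ) ^ b := by exact_mod_cast Nat.choose_le_pow a b
    refine h1.trans ?_
    rw [Real.exp_nat_mul, hLdef, Real.exp_log (by positivity)]
    exact pow_le_pow_left₀ (Nat.cast_nonneg a) ha6 b
  have h8 : (8 : ℝ) ^ b = Real.exp (3 * (b * Real.log 2)) := by
    rw [show (8 : ℝ) = 2 ^ 3 by norm_num, ← pow_mul, hpow]
    push_cast
    ring_nf
  have hfree := free_length_le hd hb hab ha hR (by positivity)
  have hrest : 4 * s ^ 6 / (b * d ^ 2) ≤ 4 * (d⁻¹ * s ^ 3) := by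
    rw [div_le_iff₀ (by positivity)]
    rw [div_le_iff₀ hd0] at hb1
    calc 4 * s ^ 6 = 4 * s ^ 3 * s ^ 3 := by ring
      _ ≤ 4 * s ^ 3 * (b * d) := by gcongr
      _ = _ := by field_simp
  have hbL : b * L ≤ d⁻¹ * s ^ 3 * L + L := by
    rw [div_eq_inv_mul] at hb2
    nlinarith
  have hb4 : b * (4 * Real.log 2) ≤ b * L := by gcongr
  push_cast
  rw [h8, hpow]
  refine (mul_le_mul_of_nonneg_right hchoose (by positivity)).trans ?_
  rw [← Real.exp_add, ← Real.exp_add, Real.exp_le_exp]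
  linarith

end Estimates

lemma maxDeg_pos_of_mad_pos [Fintype V] {G : SimpleGraph V} (h : 0 < mad G) : 1 ≤ maxDeg G := by
  by_contra h0
  have hdeg : ∀ v, deg G v = 0 := fun v => by
    have : deg G v ≤ maxDeg G := le_sup (f := deg G) (mem_univ v)
    omega
  have hadj : ∀ u v, ¬ G.Adj u v := fun u v huv => by
    have : IsEmpty (G.neighborSet u) := Finite.card_eq_zero_iff.1 (hdeg u)
    exact this.elim ⟨v, huv⟩
  refine h.not_ge (Real.iSup_le (fun X => ?_) le_rfl)
  have : IsEmpty {e : Sym2 V // e ∈ G.edgeSet ∧ ∀ v ∈ e, v ∈ X.1} :=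
    ⟨fun e => by
      obtain ⟨⟨u, v⟩, he, -⟩ := e
      exact hadj u v he⟩
  simp [edgesIn]

section Main

variable [Fintype V] [DecidableEq V]

/-- The theorem for graphs with sufficiently many vertices. -/
lemma stww_le_of_large (G : SimpleGraph V) {s : ℝ} (hs : 100 ≤ s)
    (hn : (Fintype.card V : ℝ) = Real.exp (s ^ 6)) (hd : 2 + 1 / s ≤ mad G)
    (hd6 : mad G ≤ s ^ 6) (hΔ : 1 ≤ maxDeg G) (hΔs : Real.log (maxDeg G) ≤ s) :
    (stww G : ℝ) ≤ maxDeg G * Real.exp ((mad G - 2) / (2 * mad G - 2) * s ^ 6 +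
      10 * ((mad G)⁻¹ * s ^ 3 * Real.log (s ^ 6) + Real.log (mad G))) := by
  set d := mad G with hdef
  have hs0 : 0 < s := by linarith
  have hinv : 0 < 1 / s := by positivity
  have hd2 : 2 ≤ d := by linarith
  have hd0 : 0 < d := by linarith
  have h3 : 1 ≤ s ^ 3 := one_le_pow₀ (by linarith)
  have hs36 : 100 * s ^ 3 ≤ s ^ 6 := by
    have : 100 ≤ s ^ 3 := by nlinarith [one_le_pow₀ (n := 2) (show 1 ≤ s by linarith)]
    calc 100 * s ^ 3 ≤ s ^ 3 * s ^ 3 := by gcongr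
      _ = s ^ 6 := by ring
  set b := ⌈s ^ 3 / d⌉₊ with hbdef
  have hb : 0 < b := Nat.ceil_pos.2 (by positivity)
  have hb1 : s ^ 3 / d ≤ b := Nat.le_ceil _
  have hb2 : (b : ℝ) ≤ s ^ 3 / d + 1 := (Nat.ceil_lt_add_one (by positivity)).le
  have hb' : (0 : ℝ) < b := by exact_mod_cast hb
  set a := ⌈b * d / 2⌉₊ with hadef
  have ha1 : b * d / 2 ≤ a := Nat.le_ceil _
  have ha2 : (a : ℝ) ≤ b * d / 2 + 1 := (Nat.ceil_lt_add_one (by positivity)).le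
  have hbd1 : s ^ 3 ≤ b * d := by rwa [div_le_iff₀ hd0] at hb1
  have hbd2 : b * d ≤ s ^ 3 + d := by
    calc b * d ≤ (s ^ 3 / d + 1) * d := by gcongr
      _ = _ := by field_simp
  have hab : b ≤ a := by
    have : (b : ℝ) ≤ a := by nlinarith
    exact_mod_cast this
  have ha0 : 0 < a := hb.trans_le hab
  have ha6 : (a : ℝ) ≤ s ^ 6 := by linarith
  have hl2 := Real.log_two_gt_d9
  have hα0 : 0 ≤ (d - 2) / (2 * d - 2) := div_nonneg (by linarith) (by linarith)
  have hβ0 : 0 ≤ d / (2 * d - 2) := div_nonneg (by linarith) (by linarith)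
  have hβ1 : d / (2 * d - 2) ≤ 1 := by
    rw [div_le_one (by linarith)]; linarith
  have hαβ : (d - 2) / (2 * d - 2) + d / (2 * d - 2) = 1 := by
    rw [← add_div, div_eq_one_iff_eq (by linarith)]; ring
  have hβx : 0 ≤ d / (2 * d - 2) * s ^ 6 := by positivity
  set R := ⌊d / (2 * d - 2) * s ^ 6 / Real.log 2⌋₊ with hRdef
  obtain ⟨hR1, hR2⟩ := two_pow_floor_bounds hβx
  rw [← hRdef] at hR1 hR2
  have hRlog : R * Real.log 2 ≤ d / (2 * d - 2) * s ^ 6 := by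
    rw [← le_div_iff₀ (by linarith)]
    exact Nat.floor_le (by positivity)
  have hT : ((R / a + 1 : ℕ) : ℝ) ≤ 4 * s ^ 3 := by
    have h4 : (R : ℝ) ≤ 3 / 2 * s ^ 6 := by
      have : d / (2 * d - 2) * s ^ 6 ≤ 1 * s ^ 6 := by gcongr
      have hR0 : (0 : ℝ) ≤ R := Nat.cast_nonneg R
      nlinarith
    have h5 : ((R / a : ℕ) : ℝ) ≤ (R : ℝ) / a := Nat.cast_div_le
    have h6 : (R : ℝ) / a ≤ 3 * s ^ 3 := by
      rw [div_le_iff₀ (by exact_mod_cast ha0)]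
      calc (R : ℝ) ≤ 3 / 2 * s ^ 6 := h4
        _ = 3 * s ^ 3 * (s ^ 3 / 2) := by ring
        _ ≤ 3 * s ^ 3 * a := by gcongr; linarith
    push_cast
    linarith
  set q := ⌈s ^ 6⌉₊ with hqdef
  have hq1 : s ^ 6 ≤ q := Nat.le_ceil _
  have hq2 : (q : ℝ) < s ^ 6 + 1 := Nat.ceil_lt_add_one (by positivity)
  obtain ⟨r, hrsum, hr⟩ := exists_balanced_lengths ha0 R
  have hX := near_count_le hs hd ha6 (by linarith : (q : ℝ) + 1 ≤ 2 * s ^ 6) hT hΔ hΔs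
  have key := stww_le_of_cover G (q := q) (M := ⌊7 * Real.exp ((d - 2) / (2 * d - 2) * s ^ 6)⌋₊)
    (Z := 2 ^ (R - b * (R / a))) hab (by linarith : d * b ≤ 2 * a) (Nat.succ_pos (R / a)) r
    (fun i => (hr i).2)
    (fun m hm => Nat.le_floor (class_size_le hn hαβ hβ1 (by positivity) (by linarith) hX hR1 hR2
      (hrsum ▸ hm)))
    (fun I hI => Nat.pow_le_pow_right two_pos
      (sum_compl_le_of_le hrsum (fun i => (hr i).1) hI))
  have hW := choose_mul_le hs hd2 hb hab hb1 hb2 ha2 ha6 hRlog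
  have hΔ' : (1 : ℝ) ≤ maxDeg G := by exact_mod_cast hΔ
  have hY : 0 ≤ d⁻¹ * s ^ 3 * Real.log (s ^ 6) :=
    mul_nonneg (by positivity) (Real.log_nonneg (one_le_pow₀ (by linarith)))
  have hlogd : Real.log 2 ≤ Real.log d := Real.log_le_log two_pos hd2
  have h7 : 7 * Real.exp ((d - 2) / (2 * d - 2) * s ^ 6) ≤
      Real.exp ((d - 2) / (2 * d - 2) * s ^ 6 +
        10 * (d⁻¹ * s ^ 3 * Real.log (s ^ 6) + Real.log d)) := by
    rw [Real.exp_add, mul_comm]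
    gcongr
    linarith [Real.add_one_le_exp (10 * (d⁻¹ * s ^ 3 * Real.log (s ^ 6) + Real.log d))]
  rcases le_max_iff.1 key with h | h
  · calc (stww G : ℝ) ≤ (maxDeg G : ℝ) * (⌊7 * Real.exp ((d - 2) / (2 * d - 2) * s ^ 6)⌋₊ : ℝ) := by
          exact_mod_cast h
      _ ≤ _ := by
          gcongr
          exact (Nat.floor_le (by positivity)).trans h7
  · refine le_trans ?_ (le_mul_of_one_le_left (Real.exp_pos _).le hΔ')
    exact (Nat.cast_le.2 h).trans hW

end Main

theorem statement_16 :
    ∃ C : ℝ, 0 < C ∧ ∀ (V : Type) [Fintype V] [DecidableEq V] (G : SimpleGraph V),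
      2 + Real.log (Fintype.card V) ^ (-(1 / 6 : ℝ)) ≤ mad G →
      mad G ≤ Real.log (Fintype.card V) / (30 * Real.log (Real.log (Fintype.card V))) →
      Real.log (maxDeg G) ≤ Real.log (Fintype.card V) ^ (1 / 6 : ℝ) →
      (stww G : ℝ) ≤ (maxDeg G : ℝ) *
        (Fintype.card V : ℝ) ^ ((mad G - 2) / (2 * mad G - 2)) *
        Real.exp (C * ((mad G)⁻¹ * Real.log (Fintype.card V) ^ (1 / 2 : ℝ) *
          Real.log (Real.log (Fintype.card V)) + Real.log (mad G))) := by
  refine ⟨2 * 10 ^ 12, by norm_num, ?_⟩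
  intro V _ _ G hlow hhigh hΔs
  have hℓ0 : 0 ≤ Real.log (Fintype.card V) := Real.log_natCast_nonneg _
  have hd2 : 2 ≤ mad G := by linarith [Real.rpow_nonneg hℓ0 (-(1 / 6 : ℝ))]
  have hΔ : 1 ≤ maxDeg G := maxDeg_pos_of_mad_pos (by linarith)
  have hcard : 0 < Fintype.card V := by
    rcases Nat.eq_zero_or_pos (Fintype.card V) with h | h
    · rw [h] at hhigh
      norm_num at hhigh
      linarith
    · exact h
  have hn : (Fintype.card V : ℝ) = Real.exp (Real.log (Fintype.card V)) :=
    (Real.exp_log (by exact_mod_cast hcard)).symm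
  rw [Real.rpow_def_of_pos (by exact_mod_cast hcard : (0 : ℝ) < Fintype.card V)]
  set ℓ := Real.log (Fintype.card V) with hℓdef
  set d := mad G with hdef
  have hLpos : 0 < Real.log ℓ := by
    by_contra hL
    have := div_nonpos_of_nonneg_of_nonpos hℓ0 (show 30 * Real.log ℓ ≤ 0 by linarith)
    linarith
  have hΔ' : (1 : ℝ) ≤ maxDeg G := by exact_mod_cast hΔ
  have hlogd : Real.log 2 ≤ Real.log d := Real.log_le_log two_pos hd2
  have hl2 := Real.log_two_gt_d9
  have hY : 0 ≤ d⁻¹ * ℓ ^ (1 / 2 : ℝ) * Real.log ℓ := by positivity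
  have hα0 : 0 ≤ (d - 2) / (2 * d - 2) := div_nonneg (by linarith) (by linarith)
  rw [mul_assoc, ← Real.exp_add]
  set s := ℓ ^ (1 / 6 : ℝ) with hsdef
  have hs0 : 0 ≤ s := Real.rpow_nonneg hℓ0 _
  have hs6 : s ^ 6 = ℓ := by
    rw [hsdef, ← Real.rpow_mul_natCast hℓ0]; norm_num
  have hs3 : ℓ ^ (1 / 2 : ℝ) = s ^ 3 := by
    rw [hsdef, ← Real.rpow_mul_natCast hℓ0]; norm_num
  rcases lt_or_ge s 100 with hs | hs
  · have h1 : (stww G : ℝ) ≤ Real.exp ℓ := by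
      rw [← hn]; exact_mod_cast stww_le_card G
    refine (h1.trans ?_).trans (le_mul_of_one_le_left (Real.exp_pos _).le hΔ')
    have h2 : ℓ ≤ 10 ^ 12 := by
      rw [← hs6]
      calc s ^ 6 ≤ 100 ^ 6 := pow_le_pow_left₀ hs0 hs.le 6
        _ = _ := by norm_num
    have h3 := mul_nonneg hℓ0 hα0
    rw [Real.exp_le_exp]
    linarith
  · have hneg : ℓ ^ (-(1 / 6 : ℝ)) = 1 / s := by
      rw [Real.rpow_neg hℓ0, ← hsdef, one_div s]
    rw [hneg] at hlow
    have hL1 : 1 ≤ Real.log ℓ := by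
      rw [← hs6, Real.log_pow]
      have := Real.log_le_log two_pos (by linarith : (2 : ℝ) ≤ s)
      push_cast
      linarith
    have hd6 : d ≤ s ^ 6 := by
      rw [hs6]
      exact hhigh.trans (div_le_self hℓ0 (by linarith))
    have h := stww_le_of_large G hs (by rw [hs6]; exact hn) hlow hd6 hΔ hΔs
    refine h.trans ?_
    rw [← hdef, hs6, ← hs3, mul_comm _ ℓ]
    gcongr
    · linarith
    · norm_num

end TwwPaper
end
end
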